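/- Let p_{Y1,Y2|X} be a discrete memoryless broadcast channel with finite alphabets. If p_{Y1|X} is essentially more capable than p_{Y2|X}, then 𝒞₂(p_{Y1,Y2|X}) equals the set of (R1,R2) ∈ ℝ²₊ satisfying R2 ≤ I(X;Y2) and R1+R2 ≤ I(X;Y1) for some input distribution p_X (with Y1,Y2 the outputs induced through p_{Y1,Y2|X}). -/

import Mathlib

open scoped BigOperators Classical
open Finset

noncomputable section

/-- `p` is a probability mass function on the finite type `α`. -/
def IsPMF {α : Type} [Fintype α] (p : α → ℝ) : Prop :=
  (∀ a, 0 ≤ p a) ∧ ∑ a, p a = 1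

/-- Shannon entropy (base 2) of a pmf on a finite type. -/
def Hent {α : Type} [Fintype α] (p : α → ℝ) : ℝ :=
  -∑ a, p a * Real.logb 2 (p a)

/-- Mutual information `I(A;B)` of a joint pmf on `α × β` (base-2 logarithms). -/
def MI {α β : Type} [Fintype α] [Fintype β] (p : α × β → ℝ) : ℝ :=
  Hent (fun a => ∑ b, p (a, b)) + Hent (fun b => ∑ a, p (a, b)) - Hent p

/-- Conditional mutual information `I(A;B|C)` of a joint pmf on `α × β × γ`. -/
def CMI {α β γ : Type} [Fintype α] [Fintype β] [Fintype γ] (p : α × β × γ → ℝ) : ℝ :=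
  Hent (fun ac : α × γ => ∑ b, p (ac.1, b, ac.2))
    + Hent (fun bc : β × γ => ∑ a, p (a, bc.1, bc.2))
    - Hent p
    - Hent (fun c : γ => ∑ a, ∑ b, p (a, b, c))

/-- A channel: every input letter gives a pmf on outputs. -/
def IsChannel {X Z : Type} [Fintype Z] (W : X → Z → ℝ) : Prop :=
  ∀ x, IsPMF (W x)

/-- Marginal channel to receiver 1 of a broadcast channel. -/
def margW1 {X Y1 Y2 : Type} [Fintype Y2] (W : X → Y1 × Y2 → ℝ) : X → Y1 → ℝ :=
  fun x y1 => ∑ y2, W x (y1, y2)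

/-- Marginal channel to receiver 2 of a broadcast channel. -/
def margW2 {X Y1 Y2 : Type} [Fintype Y1] (W : X → Y1 × Y2 → ℝ) : X → Y2 → ℝ :=
  fun x y2 => ∑ y1, W x (y1, y2)

/-- Memoryless `n`-fold extension of a broadcast channel. -/
def nFold {X Y1 Y2 : Type} (W : X → Y1 × Y2 → ℝ) (n : ℕ)
    (x : Fin n → X) (y : (Fin n → Y1) × (Fin n → Y2)) : ℝ :=
  ∏ t, W (x t) (y.1 t, y.2 t)

section Channel

variable {X Y1 Y2 : Type} [Fintype Y1] [Fintype Y2]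

/-- Average error probability; message `M2` known at receiver 1. -/
def errP1 (W : X → Y1 × Y2 → ℝ) (n k1 k2 : ℕ) (f : Fin k1 × Fin k2 → Fin n → X)
    (g1 : (Fin n → Y1) × Fin k2 → Fin k1) (g2 : (Fin n → Y2) → Fin k2) : ℝ :=
  (1 : ℝ) / ((k1 : ℝ) * (k2 : ℝ)) *
    ∑ m : Fin k1 × Fin k2, ∑ y : (Fin n → Y1) × (Fin n → Y2),
      nFold W n (f m) y * (if g1 (y.1, m.2) = m.1 ∧ g2 y.2 = m.2 then 0 else 1)

/-- Average error probability; message `M1` known at receiver 2. -/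
def errP2 (W : X → Y1 × Y2 → ℝ) (n k1 k2 : ℕ) (f : Fin k1 × Fin k2 → Fin n → X)
    (g1 : (Fin n → Y1) → Fin k1) (g2 : (Fin n → Y2) × Fin k1 → Fin k2) : ℝ :=
  (1 : ℝ) / ((k1 : ℝ) * (k2 : ℝ)) *
    ∑ m : Fin k1 × Fin k2, ∑ y : (Fin n → Y1) × (Fin n → Y2),
      nFold W n (f m) y * (if g1 y.1 = m.1 ∧ g2 (y.2, m.1) = m.2 then 0 else 1)

/-- Average error probability; no receiver side information. -/
def errP0 (W : X → Y1 × Y2 → ℝ) (n k1 k2 : ℕ) (f : Fin k1 × Fin k2 → Fin n → X)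
    (g1 : (Fin n → Y1) → Fin k1) (g2 : (Fin n → Y2) → Fin k2) : ℝ :=
  (1 : ℝ) / ((k1 : ℝ) * (k2 : ℝ)) *
    ∑ m : Fin k1 × Fin k2, ∑ y : (Fin n → Y1) × (Fin n → Y2),
      nFold W n (f m) y * (if g1 y.1 = m.1 ∧ g2 y.2 = m.2 then 0 else 1)

/-- Achievability of a rate pair with `M2` available at receiver 1. -/
def Ach1 (W : X → Y1 × Y2 → ℝ) (R : ℝ × ℝ) : Prop :=
  0 ≤ R.1 ∧ 0 ≤ R.2 ∧ ∀ ε : ℝ, 0 < ε →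
    ∃ (n k1 k2 : ℕ), 0 < n ∧ 0 < k1 ∧ 0 < k2 ∧
      ∃ (f : Fin k1 × Fin k2 → Fin n → X) (g1 : (Fin n → Y1) × Fin k2 → Fin k1)
        (g2 : (Fin n → Y2) → Fin k2),
        R.1 ≤ Real.logb 2 (k1 : ℝ) / (n : ℝ) ∧ R.2 ≤ Real.logb 2 (k2 : ℝ) / (n : ℝ) ∧
        errP1 W n k1 k2 f g1 g2 ≤ ε

/-- Achievability of a rate pair with `M1` available at receiver 2. -/
def Ach2 (W : X → Y1 × Y2 → ℝ) (R : ℝ × ℝ) : Prop :=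
  0 ≤ R.1 ∧ 0 ≤ R.2 ∧ ∀ ε : ℝ, 0 < ε →
    ∃ (n k1 k2 : ℕ), 0 < n ∧ 0 < k1 ∧ 0 < k2 ∧
      ∃ (f : Fin k1 × Fin k2 → Fin n → X) (g1 : (Fin n → Y1) → Fin k1)
        (g2 : (Fin n → Y2) × Fin k1 → Fin k2),
        R.1 ≤ Real.logb 2 (k1 : ℝ) / (n : ℝ) ∧ R.2 ≤ Real.logb 2 (k2 : ℝ) / (n : ℝ) ∧
        errP2 W n k1 k2 f g1 g2 ≤ ε

/-- Achievability of a rate pair with no receiver side information. -/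
def Ach0 (W : X → Y1 × Y2 → ℝ) (R : ℝ × ℝ) : Prop :=
  0 ≤ R.1 ∧ 0 ≤ R.2 ∧ ∀ ε : ℝ, 0 < ε →
    ∃ (n k1 k2 : ℕ), 0 < n ∧ 0 < k1 ∧ 0 < k2 ∧
      ∃ (f : Fin k1 × Fin k2 → Fin n → X) (g1 : (Fin n → Y1) → Fin k1)
        (g2 : (Fin n → Y2) → Fin k2),
        R.1 ≤ Real.logb 2 (k1 : ℝ) / (n : ℝ) ∧ R.2 ≤ Real.logb 2 (k2 : ℝ) / (n : ℝ) ∧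
        errP0 W n k1 k2 f g1 g2 ≤ ε

/-- Capacity region `𝒞₁`: side information `M2` at receiver 1. -/
def Cap1 (W : X → Y1 × Y2 → ℝ) : Set (ℝ × ℝ) := closure {R | Ach1 W R}

/-- Capacity region `𝒞₂`: side information `M1` at receiver 2. -/
def Cap2 (W : X → Y1 × Y2 → ℝ) : Set (ℝ × ℝ) := closure {R | Ach2 W R}

/-- Private-message capacity region `𝒞`. -/
def Cap (W : X → Y1 × Y2 → ℝ) : Set (ℝ × ℝ) := closure {R | Ach0 W R}

end Channel

/-- `κ·𝒜` for a set of rate pairs. -/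
def scaleSet (κ : ℝ) (A : Set (ℝ × ℝ)) : Set (ℝ × ℝ) :=
  (fun R : ℝ × ℝ => (κ * R.1, κ * R.2)) '' A

/-- Binary entropy function (base 2). -/
def Hb (x : ℝ) : ℝ := -(x * Real.logb 2 x) - (1 - x) * Real.logb 2 (1 - x)

/-- Binary convolution `a*b = a(1-b)+(1-a)b`. -/
def bconv (a b : ℝ) : ℝ := a * (1 - b) + (1 - a) * b

/-- The region `𝒞(BS-BC(d₁,d₂))`. -/
def CBSBC (d1 d2 : ℝ) : Set (ℝ × ℝ) :=
  {R | 0 ≤ R.1 ∧ 0 ≤ R.2 ∧ ∃ α ∈ Set.Icc (0:ℝ) (1/2),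
    R.1 ≤ Hb (bconv α d1) - Hb d1 ∧ R.2 ≤ 1 - Hb (bconv α d2)}

/-- The region `𝒞(BE-BC(ε₁,ε₂))`. -/
def CBEBC (e1 e2 : ℝ) : Set (ℝ × ℝ) :=
  {R | 0 ≤ R.1 ∧ 0 ≤ R.2 ∧ ∃ β ∈ Set.Icc (0:ℝ) 1,
    R.1 ≤ β * (1 - e1) ∧ R.2 ≤ (1 - β) * (1 - e2)}

/-- 1-norm distance between two functions on a finite type. -/
def l1dist {α : Type} [Fintype α] (p q : α → ℝ) : ℝ := ∑ a, |p a - q a|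

/-- Capacity `C(p_{Y|X}) = max_{p_X} I(X;Y)` of a point-to-point channel. -/
def Cmarg {X Y : Type} [Fintype X] [Fintype Y] (Wm : X → Y → ℝ) : ℝ :=
  sSup {r | ∃ pX : X → ℝ, IsPMF pX ∧ r = MI (fun a : X × Y => pX a.1 * Wm a.1 a.2)}

section Auxiliary

variable {X Y : Type} [Fintype X] [Fintype Y]

/-- `I(V;Y)` for an auxiliary–input joint pmf `q` on `V × X` and a marginal
channel `Wm : X → Y`. -/
def IVY {V : Type} [Fintype V] (Wm : X → Y → ℝ) (q : V × X → ℝ) : ℝ :=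
  MI (fun a : V × Y => ∑ x, q (a.1, x) * Wm x a.2)

/-- `I(X;Y|V)` for an auxiliary–input joint pmf `q` on `V × X` and a marginal
channel `Wm : X → Y`. -/
def IXYgV {V : Type} [Fintype V] (Wm : X → Y → ℝ) (q : V × X → ℝ) : ℝ :=
  CMI (fun a : X × Y × V => q (a.2.2, a.1) * Wm a.1 a.2.1)

/-- `I(X;Y)` for an input pmf `pX` and a marginal channel `Wm : X → Y`. -/
def IXY (Wm : X → Y → ℝ) (pX : X → ℝ) : ℝ :=
  MI (fun a : X × Y => pX a.1 * Wm a.1 a.2)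

end Auxiliary

section Sufficient

variable {X Y1 Y2 : Type} [Fintype X] [Fintype Y1] [Fintype Y2]

/-- `𝒫` is a sufficient class of input distributions for the broadcast channel `W`. -/
def SuffClass (W : X → Y1 × Y2 → ℝ) (P : Set (X → ℝ)) : Prop :=
  ∀ (k1 k2 : ℕ) (p : Fin k1 × Fin k2 × X → ℝ), IsPMF p →
    ∃ (k1' k2' : ℕ) (p' : Fin k1' × Fin k2' × X → ℝ), IsPMF p' ∧
      (fun x => ∑ v1, ∑ v2, p' (v1, v2, x)) ∈ P ∧
      IVY (margW1 W) (fun a : Fin k1 × X => ∑ v2, p (a.1, v2, a.2))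
        ≤ IVY (margW1 W) (fun a : Fin k1' × X => ∑ v2, p' (a.1, v2, a.2)) ∧
      IVY (margW2 W) (fun a : Fin k2 × X => ∑ v1, p (v1, a.1, a.2))
        ≤ IVY (margW2 W) (fun a : Fin k2' × X => ∑ v1, p' (v1, a.1, a.2)) ∧
      IVY (margW1 W) (fun a : Fin k1 × X => ∑ v2, p (a.1, v2, a.2))
          + IXYgV (margW2 W) (fun a : Fin k1 × X => ∑ v2, p (a.1, v2, a.2))
        ≤ IVY (margW1 W) (fun a : Fin k1' × X => ∑ v2, p' (a.1, v2, a.2))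
          + IXYgV (margW2 W) (fun a : Fin k1' × X => ∑ v2, p' (a.1, v2, a.2)) ∧
      IXYgV (margW1 W) (fun a : Fin k2 × X => ∑ v1, p (v1, a.1, a.2))
          + IVY (margW2 W) (fun a : Fin k2 × X => ∑ v1, p (v1, a.1, a.2))
        ≤ IXYgV (margW1 W) (fun a : Fin k2' × X => ∑ v1, p' (v1, a.1, a.2))
          + IVY (margW2 W) (fun a : Fin k2' × X => ∑ v1, p' (v1, a.1, a.2))

/-- `p_{Y1|X}` is essentially less noisy than `p_{Y2|X}`. -/
def EssLessNoisy (W : X → Y1 × Y2 → ℝ) : Prop :=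
  ∃ P : Set (X → ℝ), SuffClass W P ∧
    ∀ (k : ℕ) (q : Fin k × X → ℝ), IsPMF q → (fun x => ∑ v, q (v, x)) ∈ P →
      IVY (margW2 W) q ≤ IVY (margW1 W) q

/-- `p_{Y1|X}` is essentially more capable than `p_{Y2|X}`. -/
def EssMoreCapable (W : X → Y1 × Y2 → ℝ) : Prop :=
  ∃ P : Set (X → ℝ), SuffClass W P ∧
    ∀ (k : ℕ) (q : Fin k × X → ℝ), IsPMF q → (fun x => ∑ v, q (v, x)) ∈ P →
      IXYgV (margW2 W) q ≤ IXYgV (margW1 W) q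

end Sufficient

set_option linter.unusedSectionVars false

/-- Probability (mass) that `f = a`. -/
def Pr {Ω α : Type} [Fintype Ω] (μ : Ω → ℝ) (f : Ω → α) (a : α) : ℝ :=
  ∑ ω, if f ω = a then μ ω else 0

/-- Entropy of the random variable `f`. -/
def Hrv {Ω α : Type} [Fintype Ω] (μ : Ω → ℝ) (f : Ω → α) : ℝ :=
  -∑ ω, μ ω * Real.logb 2 (Pr μ f (f ω))

section RV
variable {Ω α β γ : Type} [Fintype Ω] [Fintype α] [Fintype β] [Fintype γ]

lemma sum_Pr (μ : Ω → ℝ) (f : Ω → α) (G : α → ℝ) :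
    ∑ a, Pr μ f a * G a = ∑ ω, μ ω * G (f ω) := by
  simp only [Pr, Finset.sum_mul]
  rw [Finset.sum_comm]
  refine Finset.sum_congr rfl fun ω _ => ?_
  simp [ite_mul]

lemma Hent_Pr (μ : Ω → ℝ) (f : Ω → α) : Hent (Pr μ f) = Hrv μ f := by
  unfold Hent Hrv
  rw [sum_Pr μ f (fun a => Real.logb 2 (Pr μ f a))]

lemma Hrv_congr (μ : Ω → ℝ) (f : Ω → α) (g : Ω → β)
    (h : ∀ ω ω', f ω = f ω' ↔ g ω = g ω') : Hrv μ f = Hrv μ g := by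
  unfold Hrv Pr
  simp only [h]

lemma Pr_nonneg (μ : Ω → ℝ) (hμ : ∀ ω, 0 ≤ μ ω) (f : Ω → α) (a : α) : 0 ≤ Pr μ f a := by
  unfold Pr
  refine Finset.sum_nonneg fun ω _ => ?_
  split_ifs
  · exact hμ ω
  · exact le_rfl

lemma le_Pr (μ : Ω → ℝ) (hμ : ∀ ω, 0 ≤ μ ω) (f : Ω → α) (ω : Ω) : μ ω ≤ Pr μ f (f ω) := by
  unfold Pr
  have := Finset.single_le_sum (f := fun ω' => if f ω' = f ω then μ ω' else 0)
    (s := Finset.univ) (fun ω' _ => by split_ifs; exacts [hμ ω', le_rfl]) (Finset.mem_univ ω)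
  simpa using this

lemma sum_Pr_univ (μ : Ω → ℝ) (f : Ω → α) : ∑ a, Pr μ f a = ∑ ω, μ ω := by
  have := sum_Pr μ f (fun _ => 1)
  simpa using this

lemma sum_Pr_snd (μ : Ω → ℝ) (f : Ω → α) (g : Ω → β) (a : α) :
    ∑ b, Pr μ (fun ω => (f ω, g ω)) (a, b) = Pr μ f a := by
  unfold Pr
  rw [Finset.sum_comm]
  refine Finset.sum_congr rfl fun ω _ => ?_
  by_cases h : f ω = a <;> simp [h]

lemma sum_Pr_fst (μ : Ω → ℝ) (f : Ω → α) (g : Ω → β) (b : β) :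
    ∑ a, Pr μ (fun ω => (f ω, g ω)) (a, b) = Pr μ g b := by
  unfold Pr
  rw [Finset.sum_comm]
  refine Finset.sum_congr rfl fun ω _ => ?_
  by_cases h : g ω = b <;> simp [h]

lemma Pr_congr (μ : Ω → ℝ) (f : Ω → α) (g : Ω → β) (a : α) (b : β)
    (h : ∀ ω, f ω = a ↔ g ω = b) : Pr μ f a = Pr μ g b := by
  unfold Pr
  simp only [h]

lemma Hrv_submod (μ : Ω → ℝ) (hμ : ∀ ω, 0 ≤ μ ω) (f : Ω → α) (g : Ω → β) (h : Ω → γ) :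
    Hrv μ (fun ω => (f ω, g ω, h ω)) + Hrv μ h
      ≤ Hrv μ (fun ω => (f ω, h ω)) + Hrv μ (fun ω => (g ω, h ω)) := by
  set F : Ω → α × β × γ := fun ω => (f ω, g ω, h ω) with hF
  set fh : Ω → α × γ := fun ω => (f ω, h ω) with hfh
  set gh : Ω → β × γ := fun ω => (g ω, h ω) with hgh
  let r : α × β × γ → ℝ := fun t =>
    Pr μ fh (t.1, t.2.2) * Pr μ gh (t.2.1, t.2.2) / (Pr μ F t * Pr μ h t.2.2)
  have hl2 : 0 < Real.log 2 := Real.log_pos (by norm_num)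
  have key : ∀ ω, μ ω * (Real.logb 2 (Pr μ fh (fh ω)) + Real.logb 2 (Pr μ gh (gh ω))
      - Real.logb 2 (Pr μ F (F ω)) - Real.logb 2 (Pr μ h (h ω)))
      ≤ (μ ω * r (F ω) - μ ω) / Real.log 2 := by
    intro ω
    rcases (hμ ω).eq_or_lt with h0 | h0
    · simp [← h0]
    have p1 := h0.trans_le (le_Pr μ hμ fh ω)
    have p2 := h0.trans_le (le_Pr μ hμ gh ω)
    have p3 := h0.trans_le (le_Pr μ hμ F ω)
    have p4 := h0.trans_le (le_Pr μ hμ h ω)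
    have e : Real.logb 2 (Pr μ fh (fh ω)) + Real.logb 2 (Pr μ gh (gh ω))
      - Real.logb 2 (Pr μ F (F ω)) - Real.logb 2 (Pr μ h (h ω))
      = Real.log (r (F ω)) / Real.log 2 := by
      have : r (F ω) = Pr μ fh (fh ω) * Pr μ gh (gh ω) / (Pr μ F (F ω) * Pr μ h (h ω)) := rfl
      rw [this, Real.log_div (by positivity) (by positivity), Real.log_mul p1.ne' p2.ne',
        Real.log_mul p3.ne' p4.ne']
      simp only [Real.logb]
      ring
    have rp : 0 < r (F ω) := by
      have : r (F ω) = Pr μ fh (fh ω) * Pr μ gh (gh ω) / (Pr μ F (F ω) * Pr μ h (h ω)) := rfl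
      rw [this]; positivity
    rw [e, ← mul_div_assoc]
    apply div_le_div_of_nonneg_right _ hl2.le
    have := Real.log_le_sub_one_of_pos rp
    nlinarith
  have sumr : ∑ ω, μ ω * r (F ω) ≤ ∑ ω, μ ω := by
    rw [← sum_Pr μ F r]
    calc ∑ a, Pr μ F a * r a
        ≤ ∑ a : α × β × γ, Pr μ fh (a.1, a.2.2) * Pr μ gh (a.2.1, a.2.2) / Pr μ h a.2.2 := by
          refine Finset.sum_le_sum fun a _ => ?_
          have n1 := Pr_nonneg μ hμ fh (a.1, a.2.2)
          have n2 := Pr_nonneg μ hμ gh (a.2.1, a.2.2)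
          have n4 := Pr_nonneg μ hμ h (a.2.2)
          rcases (Pr_nonneg μ hμ F a).eq_or_lt with h0 | h0
          · rw [← h0, zero_mul]; positivity
          · apply le_of_eq
            simp only [r]
            field_simp
      _ = ∑ c, ∑ a, ∑ b, Pr μ fh (a, c) * Pr μ gh (b, c) / Pr μ h c := by
          rw [Fintype.sum_prod_type]
          simp only [Fintype.sum_prod_type]
          rw [Finset.sum_comm]
          simp only [Finset.sum_comm (s := (Finset.univ : Finset α))]
          rw [Finset.sum_comm]
      _ = ∑ c, Pr μ h c * Pr μ h c / Pr μ h c := by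
          refine Finset.sum_congr rfl fun c _ => ?_
          have : ∀ a, ∑ b, Pr μ fh (a, c) * Pr μ gh (b, c) / Pr μ h c
              = Pr μ fh (a, c) * Pr μ h c / Pr μ h c := by
            intro a
            rw [← Finset.sum_div, ← Finset.mul_sum, sum_Pr_fst μ g h c]
          simp only [this]
          rw [← Finset.sum_div, ← Finset.sum_mul, sum_Pr_fst μ f h c]
      _ ≤ ∑ c, Pr μ h c := by
          refine Finset.sum_le_sum fun c _ => ?_
          rw [mul_self_div_self]
      _ = ∑ ω, μ ω := sum_Pr_univ μ h
  have tot := Finset.sum_le_sum (s := Finset.univ) fun ω _ => key ω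
  rw [← Finset.sum_div, Finset.sum_sub_distrib] at tot
  have neg : (∑ ω, μ ω * r (F ω) - ∑ ω, μ ω) / Real.log 2 ≤ 0 :=
    div_nonpos_of_nonpos_of_nonneg (by linarith) hl2.le
  have := tot.trans neg
  simp only [mul_sub, mul_add, Finset.sum_sub_distrib, Finset.sum_add_distrib] at this
  unfold Hrv
  linarith

lemma Hrv_const (μ : Ω → ℝ) (h1 : ∑ ω, μ ω = 1) (a : α) : Hrv μ (fun _ => a) = 0 := by
  simp [Hrv, Pr, h1]

lemma Hrv_subadd (μ : Ω → ℝ) (hμ : ∀ ω, 0 ≤ μ ω) (h1 : ∑ ω, μ ω = 1) (f : Ω → α) (g : Ω → β) :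
    Hrv μ (fun ω => (f ω, g ω)) ≤ Hrv μ f + Hrv μ g := by
  have := Hrv_submod μ hμ f g (fun _ => ())
  rw [Hrv_const μ h1 ()] at this
  rw [Hrv_congr μ (fun ω => (f ω, g ω)) (fun ω => (f ω, g ω, ())) (by simp),
    Hrv_congr μ f (fun ω => (f ω, ())) (by simp), Hrv_congr μ g (fun ω => (g ω, ())) (by simp)]
  linarith

/-- Fano inequality (weak form). -/
lemma fano {M Z : Type} [Fintype M] [Fintype Z] (μ : Ω → ℝ) (hμ : ∀ ω, 0 ≤ μ ω)
    (h1 : ∑ ω, μ ω = 1) (m : Ω → M) (z : Ω → Z) (g : Z → M) (ε : ℝ) (hε : 0 < ε) (hε1 : ε < 1)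
    (he : ∑ ω, (if g (z ω) = m ω then 0 else μ ω) ≤ ε) :
    Hrv μ (fun ω => (m ω, z ω)) ≤ Hrv μ z
      + (-Real.logb 2 (1 - ε) - ε * Real.logb 2 ε + ε * Real.logb 2 (Fintype.card M)) := by
  have hl2 : 0 < Real.log 2 := Real.log_pos (by norm_num)
  have : Nonempty M := by
    by_contra hM
    rw [not_nonempty_iff] at hM
    have : IsEmpty Ω := ⟨fun ω => hM.elim (m ω)⟩
    simp at h1
  have hK : (0:ℝ) < Fintype.card M := by exact_mod_cast Fintype.card_pos
  have hK1 : (1:ℝ) ≤ Fintype.card M := by exact_mod_cast Nat.succ_le_of_lt Fintype.card_pos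
  set K : ℝ := ((Fintype.card M : ℕ) : ℝ)
  set F : Ω → M × Z := fun ω => (m ω, z ω) with hF
  let q : M × Z → ℝ := fun t => if g t.2 = t.1 then 1 - ε else ε / K
  have qpos : ∀ t, 0 < q t := by
    intro t; simp only [q]; split_ifs
    · linarith
    · positivity
  let r : M × Z → ℝ := fun t => Pr μ z t.2 * q t / Pr μ F t
  have key : ∀ ω, μ ω * (Real.logb 2 (Pr μ z (z ω)) + Real.logb 2 (q (F ω))
      - Real.logb 2 (Pr μ F (F ω))) ≤ (μ ω * r (F ω) - μ ω) / Real.log 2 := by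
    intro ω
    rcases (hμ ω).eq_or_lt with h0 | h0
    · simp [← h0]
    have p2 := h0.trans_le (le_Pr μ hμ z ω)
    have p3 := h0.trans_le (le_Pr μ hμ F ω)
    have p1 := qpos (F ω)
    have er : r (F ω) = Pr μ z (z ω) * q (F ω) / Pr μ F (F ω) := rfl
    have e : Real.logb 2 (Pr μ z (z ω)) + Real.logb 2 (q (F ω))
      - Real.logb 2 (Pr μ F (F ω)) = Real.log (r (F ω)) / Real.log 2 := by
      rw [er, Real.log_div (by positivity) (by positivity), Real.log_mul p2.ne' p1.ne']
      simp only [Real.logb]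
      ring
    have rp : 0 < r (F ω) := by rw [er]; positivity
    rw [e, ← mul_div_assoc]
    apply div_le_div_of_nonneg_right _ hl2.le
    have := Real.log_le_sub_one_of_pos rp
    nlinarith
  have sumr : ∑ ω, μ ω * r (F ω) ≤ ∑ ω, μ ω := by
    rw [← sum_Pr μ F r]
    calc ∑ a, Pr μ F a * r a
        ≤ ∑ a : M × Z, Pr μ z a.2 * q a := by
          refine Finset.sum_le_sum fun a _ => ?_
          have n2 := Pr_nonneg μ hμ z a.2
          have n1 := (qpos a).le
          rcases (Pr_nonneg μ hμ F a).eq_or_lt with h0 | h0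
          · rw [← h0, zero_mul]; positivity
          · apply le_of_eq
            simp only [r]
            field_simp
      _ = ∑ c, Pr μ z c * ∑ a, q (a, c) := by
          rw [Fintype.sum_prod_type_right]
          simp only [Finset.mul_sum]
      _ ≤ ∑ c, Pr μ z c := by
          refine Finset.sum_le_sum fun c _ => ?_
          have : ∑ a, q (a, c) ≤ 1 := by
            calc ∑ a, q (a, c) ≤ ∑ a, ((if g c = a then 1 - ε else 0) + ε / K) := by
                  refine Finset.sum_le_sum fun a _ => ?_
                  simp only [q]
                  have : 0 ≤ ε / K := by positivity
                  split_ifs <;> linarith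
              _ = 1 := by
                  rw [Finset.sum_add_distrib]
                  simp only [Finset.sum_ite_eq, Finset.mem_univ, if_true, Finset.sum_const,
                    nsmul_eq_mul, Finset.card_univ]
                  change 1 - ε + K * (ε / K) = 1
                  field_simp; ring
          have n2 := Pr_nonneg μ hμ z c
          nlinarith
      _ = ∑ ω, μ ω := sum_Pr_univ μ z
  have tot := Finset.sum_le_sum (s := Finset.univ) fun ω _ => key ω
  rw [← Finset.sum_div, Finset.sum_sub_distrib] at tot
  have neg : (∑ ω, μ ω * r (F ω) - ∑ ω, μ ω) / Real.log 2 ≤ 0 :=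
    div_nonpos_of_nonpos_of_nonneg (by linarith) hl2.le
  have := tot.trans neg
  simp only [mul_sub, mul_add, Finset.sum_sub_distrib, Finset.sum_add_distrib] at this
  have l1 : Real.logb 2 (1 - ε) ≤ 0 :=
    Real.logb_nonpos (by norm_num) (by linarith) (by linarith)
  have l2 : Real.logb 2 ε ≤ 0 := Real.logb_nonpos (by norm_num) hε.le hε1.le
  have l3 : 0 ≤ Real.logb 2 K := Real.logb_nonneg (by norm_num) hK1
  have hq : Real.logb 2 (1 - ε) + ε * (Real.logb 2 ε - Real.logb 2 K)
      ≤ ∑ ω, μ ω * Real.logb 2 (q (F ω)) := by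
    calc Real.logb 2 (1 - ε) + ε * (Real.logb 2 ε - Real.logb 2 K)
        ≤ (∑ ω, μ ω) * Real.logb 2 (1 - ε)
          + (∑ ω, if g (z ω) = m ω then 0 else μ ω) * (Real.logb 2 ε - Real.logb 2 K) := by
          rw [h1]
          nlinarith
      _ = ∑ ω, (μ ω * Real.logb 2 (1 - ε)
          + (if g (z ω) = m ω then 0 else μ ω) * (Real.logb 2 ε - Real.logb 2 K)) := by
          rw [Finset.sum_add_distrib, Finset.sum_mul, Finset.sum_mul]
      _ ≤ _ := by
          refine Finset.sum_le_sum fun ω _ => ?_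
          have n := hμ ω
          simp only [q, F]
          split_ifs
          · simp
          · rw [Real.logb_div hε.ne' hK.ne']
            nlinarith
  unfold Hrv
  linarith

end RV

section Forms
variable {Ω α β γ : Type} [Fintype Ω] [Fintype α] [Fintype β] [Fintype γ]

lemma MI_Pr (μ : Ω → ℝ) (f : Ω → α) (g : Ω → β) :
    MI (Pr μ (fun ω => (f ω, g ω))) = Hrv μ f + Hrv μ g - Hrv μ (fun ω => (f ω, g ω)) := by
  unfold MI
  simp only [sum_Pr_snd, sum_Pr_fst]
  change Hent (Pr μ f) + Hent (Pr μ g) - _ = _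
  simp only [Hent_Pr]

lemma CMI_Pr (μ : Ω → ℝ) (f : Ω → α) (g : Ω → β) (h : Ω → γ) :
    CMI (Pr μ (fun ω => (f ω, g ω, h ω)))
      = Hrv μ (fun ω => (f ω, h ω)) + Hrv μ (fun ω => (g ω, h ω))
        - Hrv μ (fun ω => (f ω, g ω, h ω)) - Hrv μ h := by
  unfold CMI
  have e1 : (fun ac : α × γ => ∑ b, Pr μ (fun ω => (f ω, g ω, h ω)) (ac.1, b, ac.2))
      = Pr μ (fun ω => (f ω, h ω)) := by
    funext ac
    rw [← sum_Pr_fst μ g (fun ω => (f ω, h ω)) ac]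
    refine Finset.sum_congr rfl fun b _ => ?_
    apply Pr_congr
    intro ω
    simp only [Prod.ext_iff]
    tauto
  have e2 : (fun bc : β × γ => ∑ a, Pr μ (fun ω => (f ω, g ω, h ω)) (a, bc.1, bc.2))
      = Pr μ (fun ω => (g ω, h ω)) := by
    funext bc
    exact sum_Pr_fst μ f (fun ω => (g ω, h ω)) bc
  have e3 : (fun c : γ => ∑ a, ∑ b, Pr μ (fun ω => (f ω, g ω, h ω)) (a, b, c)) = Pr μ h := by
    funext c
    rw [Finset.sum_comm]
    rw [← sum_Pr_fst μ g h c]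
    refine Finset.sum_congr rfl fun b _ => ?_
    exact sum_Pr_fst μ f (fun ω => (g ω, h ω)) (b, c)
  rw [e1, e2, e3]
  simp only [Hent_Pr]

lemma Hrv_cond {X : Type} (Wm : X → β → ℝ) (hW : IsChannel Wm) (μ : Ω → ℝ)
    (T : Ω → α) (Y : Ω → β) (φ : α → X)
    (hM : ∀ t y, Pr μ (fun ω => (T ω, Y ω)) (t, y) = Pr μ T t * Wm (φ t) y) :
    Hrv μ (fun ω => (T ω, Y ω)) = Hrv μ T + ∑ ω, μ ω * Hent (Wm (φ (T ω))) := by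
  rw [← Hent_Pr, ← Hent_Pr, ← sum_Pr μ T (fun t => Hent (Wm (φ t)))]
  unfold Hent
  rw [Fintype.sum_prod_type]
  simp only [hM]
  rw [← Finset.sum_neg_distrib, ← Finset.sum_neg_distrib, ← Finset.sum_add_distrib]
  refine Finset.sum_congr rfl fun t _ => ?_
  have hs := (hW (φ t)).2
  calc -∑ y, Pr μ T t * Wm (φ t) y * Real.logb 2 (Pr μ T t * Wm (φ t) y)
      = -∑ y, (Pr μ T t * Real.logb 2 (Pr μ T t) * Wm (φ t) y
          + Pr μ T t * (Wm (φ t) y * Real.logb 2 (Wm (φ t) y))) := by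
        congr 1
        refine Finset.sum_congr rfl fun y _ => ?_
        by_cases h1 : Pr μ T t = 0
        · simp [h1]
        by_cases h2 : Wm (φ t) y = 0
        · simp [h2]
        rw [Real.logb_mul h1 h2]; ring
    _ = _ := by
        rw [Finset.sum_add_distrib, ← Finset.mul_sum, ← Finset.mul_sum, hs]
        ring

lemma IXY_Pr {X Y : Type} [Fintype X] [Fintype Y] (Wm : X → Y → ℝ) (hW : IsChannel Wm)
    (μ : Ω → ℝ) (x : Ω → X) (y : Ω → Y)
    (hM : ∀ a b, Pr μ (fun ω => (x ω, y ω)) (a, b) = Pr μ x a * Wm a b) :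
    IXY Wm (Pr μ x) = Hrv μ y - ∑ ω, μ ω * Hent (Wm (x ω)) := by
  have : IXY Wm (Pr μ x) = MI (Pr μ (fun ω => (x ω, y ω))) := by
    unfold IXY
    congr 1
    funext a
    rw [← hM]
  rw [this, MI_Pr, Hrv_cond Wm hW μ x y id hM]
  simp

lemma IVY_Pr {X Y : Type} [Fintype X] [Fintype Y] (Wm : X → Y → ℝ)
    (μ : Ω → ℝ) (v : Ω → α) (x : Ω → X) (y : Ω → Y)
    (hM : ∀ c a b, Pr μ (fun ω => ((v ω, x ω), y ω)) ((c, a), b)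
      = Pr μ (fun ω => (v ω, x ω)) (c, a) * Wm a b) :
    IVY Wm (Pr μ (fun ω => (v ω, x ω)))
      = Hrv μ v + Hrv μ y - Hrv μ (fun ω => (v ω, y ω)) := by
  rw [← MI_Pr]
  unfold IVY
  congr 1
  funext a
  simp only [← hM]
  rw [← sum_Pr_fst μ x (fun ω => (v ω, y ω)) a]
  refine Finset.sum_congr rfl fun b _ => ?_
  apply Pr_congr
  intro ω
  simp only [Prod.ext_iff]
  tauto

lemma IXYgV_Pr {X Y : Type} [Fintype X] [Fintype Y] (Wm : X → Y → ℝ) (hW : IsChannel Wm)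
    (μ : Ω → ℝ) (v : Ω → α) (x : Ω → X) (y : Ω → Y)
    (hM : ∀ c a b, Pr μ (fun ω => ((v ω, x ω), y ω)) ((c, a), b)
      = Pr μ (fun ω => (v ω, x ω)) (c, a) * Wm a b) :
    IXYgV Wm (Pr μ (fun ω => (v ω, x ω)))
      = Hrv μ (fun ω => (v ω, y ω)) - Hrv μ v - ∑ ω, μ ω * Hent (Wm (x ω)) := by
  have : IXYgV Wm (Pr μ (fun ω => (v ω, x ω))) = CMI (Pr μ (fun ω => (x ω, y ω, v ω))) := by
    unfold IXYgV
    congr 1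
    funext a
    rw [← hM]
    apply Pr_congr
    intro ω
    simp only [Prod.ext_iff]
    tauto
  rw [this, CMI_Pr]
  have h := Hrv_cond Wm hW μ (fun ω => (v ω, x ω)) y Prod.snd (fun t b => hM t.1 t.2 b)
  rw [Hrv_congr μ (fun ω => (x ω, y ω, v ω)) (fun ω => ((v ω, x ω), y ω))
    (by intro ω ω'; simp only [Prod.ext_iff]; tauto), h,
    Hrv_congr μ (fun ω => (x ω, v ω)) (fun ω => (v ω, x ω))
    (by intro ω ω'; simp only [Prod.ext_iff]; tauto),
    Hrv_congr μ (fun ω => (y ω, v ω)) (fun ω => (v ω, y ω))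
    (by intro ω ω'; simp only [Prod.ext_iff]; tauto)]
  ring

lemma IXYgV_Pr_nonneg {X Y : Type} [Fintype X] [Fintype Y] (Wm : X → Y → ℝ)
    (μ : Ω → ℝ) (hμ : ∀ ω, 0 ≤ μ ω) (v : Ω → α) (x : Ω → X) (y : Ω → Y)
    (hM : ∀ c a b, Pr μ (fun ω => ((v ω, x ω), y ω)) ((c, a), b)
      = Pr μ (fun ω => (v ω, x ω)) (c, a) * Wm a b) :
    0 ≤ IXYgV Wm (Pr μ (fun ω => (v ω, x ω))) := by
  have : IXYgV Wm (Pr μ (fun ω => (v ω, x ω))) = CMI (Pr μ (fun ω => (x ω, y ω, v ω))) := by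
    unfold IXYgV
    congr 1
    funext a
    rw [← hM]
    apply Pr_congr
    intro ω
    simp only [Prod.ext_iff]
    tauto
  rw [this, CMI_Pr]
  have := Hrv_submod μ hμ x y v
  linarith

end Forms

lemma chain_general {V X Y : Type} [Fintype V] [Fintype X] [Fintype Y] (Wm : X → Y → ℝ)
    (hW : IsChannel Wm) (q : V × X → ℝ) (hq : ∀ a, 0 ≤ q a) :
    IVY Wm q + IXYgV Wm q = IXY Wm (fun x => ∑ v, q (v, x)) ∧ 0 ≤ IXYgV Wm q := by
  let μ : (V × X) × Y → ℝ := fun a => q a.1 * Wm a.1.2 a.2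
  have hμ : ∀ ω, 0 ≤ μ ω := fun a => mul_nonneg (hq _) ((hW _).1 _)
  let v : (V × X) × Y → V := fun a => a.1.1
  let x : (V × X) × Y → X := fun a => a.1.2
  let y : (V × X) × Y → Y := fun a => a.2
  have e0 : Pr μ (fun ω => (v ω, x ω)) = q := by
    funext a
    unfold Pr
    rw [Fintype.sum_prod_type]
    simp only [μ, v, x]
    have : ∀ b : V × X, (∑ c, if (b.1, b.2) = a then q b * Wm b.2 c else 0)
        = if b = a then q b else 0 := by
      intro b
      by_cases h : b = a
      · subst h
        simp [← Finset.mul_sum, (hW b.2).2]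
      · simp [h]
    simp only [this]
    simp
  have e1 : ∀ a, Pr μ (fun ω => ((v ω, x ω), y ω)) a = μ a := by
    intro a
    unfold Pr
    simp [v, x, y]
  have hM : ∀ c a b, Pr μ (fun ω => ((v ω, x ω), y ω)) ((c, a), b)
      = Pr μ (fun ω => (v ω, x ω)) (c, a) * Wm a b := by
    intro c a b
    rw [e0, e1]
  have e2 : (fun x => ∑ v, q (v, x)) = Pr μ x := by
    funext a
    rw [← e0]
    exact sum_Pr_fst μ v x a
  have hM2 : ∀ a b, Pr μ (fun ω => (x ω, y ω)) (a, b) = Pr μ x a * Wm a b := by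
    intro a b
    rw [← sum_Pr_fst μ v x a, Finset.sum_mul]
    simp only [← hM]
    rw [← sum_Pr_fst μ v (fun ω => (x ω, y ω)) (a, b)]
    refine Finset.sum_congr rfl fun c _ => ?_
    apply Pr_congr
    intro ω
    simp only [Prod.ext_iff]
    tauto
  rw [e2, ← e0]
  refine ⟨?_, IXYgV_Pr_nonneg Wm μ hμ v x y hM⟩
  rw [IVY_Pr Wm μ v x y hM, IXYgV_Pr Wm hW μ v x y hM, IXY_Pr Wm hW μ x y hM2]
  ring

/-- The use of the essentially-more-capable hypothesis. -/
lemma use_mc {X Y1 Y2 V Ω : Type} [Fintype X] [Fintype Y1] [Fintype Y2] [Fintype V] [Fintype Ω]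
    (W : X → Y1 × Y2 → ℝ) (hmc : EssMoreCapable W)
    (hW1 : IsChannel (margW1 W)) (hW2 : IsChannel (margW2 W))
    (μ : Ω → ℝ) (hμ : ∀ ω, 0 ≤ μ ω) (h1 : ∑ ω, μ ω = 1)
    (v : Ω → V) (x : Ω → X) (y1 : Ω → Y1) (y2 : Ω → Y2)
    (hM1 : ∀ c a b, Pr μ (fun ω => ((v ω, x ω), y1 ω)) ((c, a), b)
      = Pr μ (fun ω => (v ω, x ω)) (c, a) * margW1 W a b)
    (hM2 : ∀ c a b, Pr μ (fun ω => ((v ω, x ω), y2 ω)) ((c, a), b)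
      = Pr μ (fun ω => (v ω, x ω)) (c, a) * margW2 W a b) :
    ∃ pX : X → ℝ, IsPMF pX ∧
      Hrv μ y2 - ∑ ω, μ ω * Hent (margW2 W (x ω)) ≤ IXY (margW2 W) pX ∧
      Hrv μ y1 - Hrv μ (fun ω => (v ω, y1 ω)) + Hrv μ (fun ω => (v ω, y2 ω))
        - ∑ ω, μ ω * Hent (margW2 W (x ω)) ≤ IXY (margW1 W) pX := by
  obtain ⟨P, hP, hmc⟩ := hmc
  let e := Fintype.equivFin V
  let e' := Fintype.equivFin X
  let v' : Ω → Fin (Fintype.card V) := fun ω => e (v ω)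
  let x' : Ω → Fin (Fintype.card X) := fun ω => e' (x ω)
  let p := Pr μ (fun ω => (v' ω, x' ω, x ω))
  have hp : IsPMF p := ⟨fun a => Pr_nonneg μ hμ _ a, by rw [sum_Pr_univ, h1]⟩
  have ev : (fun a : Fin (Fintype.card V) × X => ∑ v2, p (a.1, v2, a.2))
      = Pr μ (fun ω => (v' ω, x ω)) := by
    funext a
    rw [← sum_Pr_fst μ x' (fun ω => (v' ω, x ω)) a]
    refine Finset.sum_congr rfl fun c _ => ?_
    apply Pr_congr
    intro ω
    simp only [Prod.ext_iff]
    tauto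
  have ex : (fun a : Fin (Fintype.card X) × X => ∑ v1, p (v1, a.1, a.2))
      = Pr μ (fun ω => (x' ω, x ω)) := by
    funext a
    exact sum_Pr_fst μ v' (fun ω => (x' ω, x ω)) a
  have relabeled : ∀ {Y : Type} [Fintype Y] (Wm : X → Y → ℝ) (y : Ω → Y),
      (∀ c a b, Pr μ (fun ω => ((v ω, x ω), y ω)) ((c, a), b)
        = Pr μ (fun ω => (v ω, x ω)) (c, a) * Wm a b) →
      (∀ c a b, Pr μ (fun ω => ((v' ω, x ω), y ω)) ((c, a), b)
        = Pr μ (fun ω => (v' ω, x ω)) (c, a) * Wm a b) := by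
    intro Y _ Wm y h c a b
    have := h (e.symm c) a b
    rw [Pr_congr μ (fun ω => ((v' ω, x ω), y ω)) (fun ω => ((v ω, x ω), y ω)) ((c, a), b)
      ((e.symm c, a), b) (by intro ω; simp [v', Equiv.eq_symm_apply]), this]
    congr 1
    exact Pr_congr μ _ _ _ _ (by intro ω; simp [v', Equiv.eq_symm_apply])
  have hM2' : ∀ a b, Pr μ (fun ω => (x ω, y2 ω)) (a, b) = Pr μ x a * margW2 W a b := by
    intro a b
    rw [← sum_Pr_fst μ v x a, Finset.sum_mul]
    simp only [← hM2]
    rw [← sum_Pr_fst μ v (fun ω => (x ω, y2 ω)) (a, b)]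
    refine Finset.sum_congr rfl fun c _ => ?_
    apply Pr_congr
    intro ω
    simp only [Prod.ext_iff]
    tauto
  have hMx : ∀ c a b, Pr μ (fun ω => ((x' ω, x ω), y2 ω)) ((c, a), b)
        = Pr μ (fun ω => (x' ω, x ω)) (c, a) * margW2 W a b := by
    intro c a b
    by_cases h : c = e' a
    · subst h
      rw [Pr_congr μ (fun ω => ((x' ω, x ω), y2 ω)) (fun ω => (x ω, y2 ω)) ((e' a, a), b) (a, b)
        (by intro ω; simp [x']), hM2']
      congr 1
      exact Pr_congr μ _ _ _ _ (by intro ω; simp [x'])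
    · have z1 : Pr μ (fun ω => ((x' ω, x ω), y2 ω)) ((c, a), b) = 0 := by
        unfold Pr
        refine Finset.sum_eq_zero fun ω _ => if_neg ?_
        simp only [x', Prod.ext_iff]
        rintro ⟨⟨h1, h2⟩, -⟩
        exact h (by rw [← h1, h2])
      have z2 : Pr μ (fun ω => (x' ω, x ω)) (c, a) = 0 := by
        unfold Pr
        refine Finset.sum_eq_zero fun ω _ => if_neg ?_
        simp only [x', Prod.ext_iff]
        rintro ⟨h1, h2⟩
        exact h (by rw [← h1, h2])
      rw [z1, z2, zero_mul]
  obtain ⟨k1, k2, p', hp', hmem, -, i2, i3, -⟩ := hP _ _ p hp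
  rw [ev] at i3
  rw [ex] at i2
  rw [IVY_Pr _ μ v' x y1 (relabeled _ _ hM1), IXYgV_Pr _ hW2 μ v' x y2 (relabeled _ _ hM2)] at i3
  rw [IVY_Pr _ μ x' x y2 hMx] at i2
  set q1 : Fin k1 × X → ℝ := fun a => ∑ v2, p' (a.1, v2, a.2) with hq1
  set q2 : Fin k2 × X → ℝ := fun a => ∑ v1, p' (v1, a.1, a.2) with hq2
  have n1 : ∀ a, 0 ≤ q1 a := fun a => Finset.sum_nonneg fun _ _ => hp'.1 _
  have n2 : ∀ a, 0 ≤ q2 a := fun a => Finset.sum_nonneg fun _ _ => hp'.1 _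
  have s1 : ∑ x, ∑ v1, ∑ v2, p' (v1, v2, x) = 1 := by
    rw [← hp'.2, Fintype.sum_prod_type]
    simp only [Fintype.sum_prod_type]
    rw [Finset.sum_comm]
    refine Finset.sum_congr rfl fun c _ => ?_
    rw [Finset.sum_comm]
  have pq1 : IsPMF q1 := ⟨n1, by
    rw [Fintype.sum_prod_type, Finset.sum_comm, ← s1]⟩
  have c1 := chain_general (margW1 W) hW1 q1 n1
  have c2 := chain_general (margW2 W) hW2 q2 n2
  have m1 := hmc k1 q1 pq1 hmem
  have eqX : (fun x => ∑ v, q2 (v, x)) = (fun x => ∑ v, q1 (v, x)) := by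
    funext x
    simp only [hq1, hq2]
    rw [Finset.sum_comm]
  rw [eqX] at c2
  refine ⟨fun x => ∑ v, q1 (v, x), ⟨fun a => Finset.sum_nonneg fun _ _ => n1 _, ?_⟩, ?_, ?_⟩
  · rw [← s1]
  · have h := Hrv_cond (margW2 W) hW2 μ x y2 id hM2'
    have hx : Hrv μ x' = Hrv μ x := Hrv_congr μ _ _ (by intro ω ω'; simp [x'])
    have hxy : Hrv μ (fun ω => (x' ω, y2 ω)) = Hrv μ (fun ω => (x ω, y2 ω)) :=
      Hrv_congr μ _ _ (by intro ω ω'; simp [x'])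
    simp only [id] at h
    linarith [c2.1, c2.2]
  · have hv : Hrv μ v' = Hrv μ v := Hrv_congr μ _ _ (by intro ω ω'; simp [v'])
    have h1 : Hrv μ (fun ω => (v' ω, y1 ω)) = Hrv μ (fun ω => (v ω, y1 ω)) :=
      Hrv_congr μ _ _ (by intro ω ω'; simp [v'])
    have h2 : Hrv μ (fun ω => (v' ω, y2 ω)) = Hrv μ (fun ω => (v ω, y2 ω)) :=
      Hrv_congr μ _ _ (by intro ω ω'; simp [v'])
    linarith [c1.1]

section Prod
variable {ι α : Type} [Fintype ι] [DecidableEq ι] [Fintype α]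

lemma prod_split (w : ι → α → ℝ) (i : ι) (hw : ∑ a, w i a = 1) (F : α → ℝ) (G : (ι → α) → ℝ)
    (hG : ∀ y y' : ι → α, (∀ j, j ≠ i → y j = y' j) → G y = G y') :
    ∑ y : ι → α, (∏ j, w j (y j)) * (F (y i) * G y)
      = (∑ a, w i a * F a) * ∑ y : ι → α, (∏ j, w j (y j)) * G y := by
  have hne : Nonempty α := by
    by_contra h
    rw [not_nonempty_iff] at h
    simp at hw
  obtain ⟨a0⟩ := hne
  let e := Equiv.funSplitAt i α
  let H : ({j // j ≠ i} → α) → ℝ := fun z => G (e.symm (a0, z))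
  let Q : ({j // j ≠ i} → α) → ℝ := fun z => ∏ j : {j // j ≠ i}, w j (z j)
  have hi : ∀ a z, e.symm (a, z) i = a := by intro a z; simp [e]
  have hj : ∀ a z (j : {j // j ≠ i}), e.symm (a, z) j = z j := by
    intro a z j
    simp [e, j.2]
  have hGH : ∀ a z, G (e.symm (a, z)) = H z := by
    intro a z
    apply hG
    intro j hji
    rw [hj a z ⟨j, hji⟩, hj a0 z ⟨j, hji⟩]
  have hP : ∀ a z, ∏ j, w j (e.symm (a, z) j) = w i a * Q z := by
    intro a z
    rw [Fintype.prod_eq_mul_prod_subtype_ne _ i, hi]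
    congr 1
    refine Finset.prod_congr rfl fun j _ => ?_
    rw [hj]
  have gen : ∀ F : α → ℝ, ∑ y : ι → α, (∏ j, w j (y j)) * (F (y i) * G y)
      = (∑ a, w i a * F a) * ∑ z, Q z * H z := by
    intro F
    rw [← e.symm.sum_comp, Fintype.sum_prod_type, Finset.sum_mul]
    refine Finset.sum_congr rfl fun a _ => ?_
    rw [Finset.mul_sum]
    refine Finset.sum_congr rfl fun z _ => ?_
    rw [hP, hi, hGH]
    ring
  have g1 := gen (fun _ => 1)
  simp only [one_mul, mul_one, hw] at g1
  rw [gen F, g1]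

lemma prod_total (w : ι → α → ℝ) (hw : ∀ i, ∑ a, w i a = 1) :
    ∑ y : ι → α, (∏ j, w j (y j)) = 1 := by
  have := Finset.prod_univ_sum (fun _ : ι => (Finset.univ : Finset α)) w
  rw [Fintype.piFinset_univ] at this
  rw [← this]
  simp [hw]

lemma prod_marg (w : ι → α → ℝ) (hw : ∀ i, ∑ a, w i a = 1) (i : ι) (F : α → ℝ) :
    ∑ y : ι → α, (∏ j, w j (y j)) * F (y i) = ∑ a, w i a * F a := by
  have := prod_split w i (hw i) F (fun _ => 1) (fun _ _ _ => rfl)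
  simpa [prod_total w hw] using this

lemma prod_marg2 (w : ι → α → ℝ) (hw : ∀ i, ∑ a, w i a = 1) (i i' : ι) (h : i' ≠ i)
    (F G : α → ℝ) :
    ∑ y : ι → α, (∏ j, w j (y j)) * (F (y i) * G (y i'))
      = (∑ a, w i a * F a) * ∑ a, w i' a * G a := by
  rw [prod_split w i (hw i) F (fun y => G (y i')) (fun y y' hy => by rw [hy i' h]),
    prod_marg w hw]

lemma Hent_prod (w : ι → α → ℝ) (hw : ∀ i, ∑ a, w i a = 1) :
    Hent (fun y : ι → α => ∏ j, w j (y j)) = ∑ i, Hent (w i) := by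
  unfold Hent
  rw [Finset.sum_neg_distrib]
  congr 1
  calc ∑ y : ι → α, (∏ j, w j (y j)) * Real.logb 2 (∏ j, w j (y j))
      = ∑ y : ι → α, ∑ i, (∏ j, w j (y j)) * Real.logb 2 (w i (y i)) := by
        refine Finset.sum_congr rfl fun y _ => ?_
        by_cases h : ∏ j, w j (y j) = 0
        · simp [h]
        · rw [← Finset.mul_sum]
          congr 1
          have h := Finset.prod_ne_zero_iff.1 h
          simp only [Real.logb]
          rw [Real.log_prod h, Finset.sum_div]
    _ = _ := by
        rw [Finset.sum_comm]
        refine Finset.sum_congr rfl fun i _ => ?_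
        exact prod_marg w hw i (fun a => Real.logb 2 (w i a))

/-- Marginalising a product weight coordinatewise. -/
lemma prod_push {B : Type} (w : ι → α → ℝ) (g : α → B) (b : ι → B) :
    ∑ y : ι → α, (if (fun j => g (y j)) = b then ∏ j, w j (y j) else 0)
      = ∏ j, ∑ a, if g a = b j then w j a else 0 := by
  rw [Finset.prod_univ_sum (fun _ : ι => (Finset.univ : Finset α)), Fintype.piFinset_univ]
  refine Finset.sum_congr rfl fun y _ => ?_
  by_cases h : (fun j => g (y j)) = b
  · rw [if_pos h]
    refine Finset.prod_congr rfl fun j _ => ?_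
    rw [if_pos (congrFun h j)]
  · rw [if_neg h]
    have : ∃ j, g (y j) ≠ b j := by
      by_contra hc
      push Not at hc
      exact h (funext hc)
    obtain ⟨j, hj⟩ := this
    exact (Finset.prod_eq_zero (Finset.mem_univ j) (if_neg hj)).symm

end Prod

lemma Hrv_pi {Ω β : Type} [Fintype Ω] [Fintype β] (μ : Ω → ℝ) (hμ : ∀ ω, 0 ≤ μ ω)
    (h1 : ∑ ω, μ ω = 1) : ∀ (n : ℕ) (f : Fin n → Ω → β),
    Hrv μ (fun ω j => f j ω) ≤ ∑ j, Hrv μ (f j) := by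
  intro n
  induction n with
  | zero =>
    intro f
    rw [Hrv_congr μ (fun ω (j : Fin 0) => f j ω) (fun _ => ())
      (by intro ω ω'; simp [funext_iff]), Hrv_const μ h1]
    simp
  | succ n ih =>
    intro f
    rw [Fin.sum_univ_succ]
    have := Hrv_subadd μ hμ h1 (f 0) (fun ω (j : Fin n) => f j.succ ω)
    rw [Hrv_congr μ (fun ω j => f j ω) (fun ω => (f 0 ω, fun (j : Fin n) => f j.succ ω))
      (by intro ω ω'; simp [funext_iff, Fin.forall_fin_succ])]
    linarith [ih (fun j => f j.succ)]

lemma Hrv_timeshare {Ω β : Type} [Fintype Ω] [Fintype β] (μ : Ω → ℝ) (hμ : ∀ ω, 0 ≤ μ ω)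
    (h1 : ∑ ω, μ ω = 1) (n : ℕ) (hn : 0 < n) (F : Fin n × Ω → β)
    (hF : ∀ a b, F a = F b → a.1 = b.1) :
    Hrv (fun a : Fin n × Ω => μ a.2 / n) F
      = Real.logb 2 n + (∑ i, Hrv μ (fun ω => F (i, ω))) / n := by
  have hn' : (0:ℝ) < n := by exact_mod_cast hn
  have hP : ∀ i ω, Pr (fun a : Fin n × Ω => μ a.2 / n) F (F (i, ω))
      = Pr μ (fun ω => F (i, ω)) (F (i, ω)) / n := by
    intro i ω
    unfold Pr
    rw [Fintype.sum_prod_type, Finset.sum_eq_single i]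
    · rw [Finset.sum_div]
      refine Finset.sum_congr rfl fun ω' _ => ?_
      split_ifs <;> simp
    · intro j _ hj
      refine Finset.sum_eq_zero fun ω' _ => if_neg fun h => hj ?_
      exact hF _ _ h
    · simp
  have : ∀ i ω, μ ω / n * Real.logb 2 (Pr μ (fun ω => F (i, ω)) (F (i, ω)) / n)
      = μ ω * Real.logb 2 (Pr μ (fun ω => F (i, ω)) (F (i, ω))) / n
        - μ ω * (Real.logb 2 n / n) := by
    intro i ω
    rcases (hμ ω).eq_or_lt with h0 | h0
    · simp [← h0]
    have p := h0.trans_le (le_Pr μ hμ (fun ω => F (i, ω)) ω)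
    rw [Real.logb_div p.ne' hn'.ne']
    ring
  unfold Hrv
  rw [Fintype.sum_prod_type]
  simp only [hP, this, Finset.sum_sub_distrib, ← Finset.sum_mul, h1, ← Finset.sum_div,
    Finset.sum_neg_distrib]
  simp
  field_simp
  ring

lemma margW1_eq {X Y1 Y2 : Type} [Fintype Y1] [Fintype Y2] (W : X → Y1 × Y2 → ℝ) (x : X)
    (b : Y1) : (∑ u : Y1 × Y2, if u.1 = b then W x u else 0) = margW1 W x b := by
  unfold margW1
  rw [Fintype.sum_prod_type, Finset.sum_eq_single b]
  · simp
  · intro c _ hc; simp [hc]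
  · simp

lemma margW2_eq {X Y1 Y2 : Type} [Fintype Y1] [Fintype Y2] (W : X → Y1 × Y2 → ℝ) (x : X)
    (b : Y2) : (∑ u : Y1 × Y2, if u.2 = b then W x u else 0) = margW2 W x b := by
  unfold margW2
  rw [Fintype.sum_prod_type_right, Finset.sum_eq_single b]
  · simp
  · intro c _ hc; simp [hc]
  · simp

lemma margW1_channel {X Y1 Y2 : Type} [Fintype Y1] [Fintype Y2] (W : X → Y1 × Y2 → ℝ)
    (hW : IsChannel W) : IsChannel (margW1 W) := fun x =>
  ⟨fun _ => Finset.sum_nonneg fun _ _ => (hW x).1 _, by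
    rw [← (hW x).2, Fintype.sum_prod_type]; rfl⟩

lemma margW2_channel {X Y1 Y2 : Type} [Fintype Y1] [Fintype Y2] (W : X → Y1 × Y2 → ℝ)
    (hW : IsChannel W) : IsChannel (margW2 W) := fun x =>
  ⟨fun _ => Finset.sum_nonneg fun _ _ => (hW x).1 _, by
    rw [← (hW x).2, Fintype.sum_prod_type_right]; rfl⟩

section Conv
variable {X Y1 Y2 : Type} [Fintype X] [Fintype Y1] [Fintype Y2]
variable {n k1 k2 : ℕ}

/-- Joint law of messages and outputs. -/
def cμ (W : X → Y1 × Y2 → ℝ) (f : Fin k1 × Fin k2 → Fin n → X)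
    (ω : (Fin k1 × Fin k2) × (Fin n → Y1 × Y2)) : ℝ :=
  1 / ((k1 : ℝ) * k2) * ∏ j, W (f ω.1 j) (ω.2 j)

lemma cμ_nonneg (W : X → Y1 × Y2 → ℝ) (hW : IsChannel W) (f : Fin k1 × Fin k2 → Fin n → X) (ω) :
    0 ≤ cμ W f ω :=
  mul_nonneg (by positivity) (Finset.prod_nonneg fun _ _ => (hW _).1 _)

lemma cμ_sum (W : X → Y1 × Y2 → ℝ) (hW : IsChannel W) (f : Fin k1 × Fin k2 → Fin n → X)
    (h1 : 0 < k1) (h2 : 0 < k2) : ∑ ω, cμ W f ω = 1 := by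
  unfold cμ
  rw [Fintype.sum_prod_type]
  simp only [← Finset.mul_sum]
  have : ∀ m : Fin k1 × Fin k2, ∑ y : Fin n → Y1 × Y2, ∏ j, W (f m j) (y j) = 1 := fun m =>
    prod_total (fun j => W (f m j)) (fun j => (hW _).2)
  simp only [this]
  have h1' : (k1:ℝ) ≠ 0 := by positivity
  have h2' : (k2:ℝ) ≠ 0 := by positivity
  simp
  field_simp

lemma cμ_Pr_M (W : X → Y1 × Y2 → ℝ) (hW : IsChannel W) (f : Fin k1 × Fin k2 → Fin n → X) (m) :
    Pr (cμ W f) (fun ω => ω.1) m = 1 / ((k1 : ℝ) * k2) := by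
  unfold Pr cμ
  rw [Fintype.sum_prod_type, Finset.sum_eq_single m]
  · simp only [if_true, ← Finset.mul_sum]
    rw [prod_total (fun j => W (f m j)) (fun j => (hW _).2), mul_one]
  · intro b _ hb; simp [hb]
  · simp

lemma cμ_Hrv_M (W : X → Y1 × Y2 → ℝ) (hW : IsChannel W) (f : Fin k1 × Fin k2 → Fin n → X)
    (h1 : 0 < k1) (h2 : 0 < k2) :
    Hrv (cμ W f) (fun ω => ω.1) = Real.logb 2 k1 + Real.logb 2 k2 := by
  unfold Hrv
  simp only [cμ_Pr_M W hW f]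
  rw [← Finset.sum_mul, cμ_sum W hW f h1 h2]
  have h1' : (k1:ℝ) ≠ 0 := by positivity
  have h2' : (k2:ℝ) ≠ 0 := by positivity
  rw [one_div, Real.logb_inv, Real.logb_mul h1' h2']
  ring

lemma cμ_Hrv_MY2 (W : X → Y1 × Y2 → ℝ) (hW : IsChannel W) (f : Fin k1 × Fin k2 → Fin n → X)
    (h1 : 0 < k1) (h2 : 0 < k2) :
    Hrv (cμ W f) (fun ω => (ω.1, fun j => (ω.2 j).2))
      = Real.logb 2 k1 + Real.logb 2 k2
        + ∑ i, ∑ ω, cμ W f ω * Hent (margW2 W (f ω.1 i)) := by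
  have hc := margW2_channel W hW
  have hch : IsChannel (fun (m : Fin k1 × Fin k2) (y : Fin n → Y2) =>
      ∏ j, margW2 W (f m j) (y j)) := fun m =>
    ⟨fun y => Finset.prod_nonneg fun _ _ => (hc _).1 _,
      prod_total (fun j => margW2 W (f m j)) (fun j => (hc _).2)⟩
  rw [Hrv_cond _ hch (cμ W f) (fun ω => ω.1) (fun ω j => (ω.2 j).2) id, cμ_Hrv_M W hW f h1 h2]
  · rw [Finset.sum_comm]
    congr 1
    refine Finset.sum_congr rfl fun ω _ => ?_
    rw [← Finset.mul_sum]
    congr 1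
    exact Hent_prod (fun j => margW2 W (f ω.1 j)) (fun j => (hc _).2)
  · intro m y
    rw [cμ_Pr_M W hW f]
    unfold Pr cμ
    rw [Fintype.sum_prod_type, Finset.sum_eq_single m]
    · have := prod_push (fun j => W (f m j)) Prod.snd y
      simp only [margW2_eq] at this
      simp only [id]
      rw [← this, Finset.mul_sum]
      refine Finset.sum_congr rfl fun z _ => ?_
      simp only [Prod.mk.injEq, true_and]
      split_ifs <;> simp
    · intro b _ hb; simp [hb]
    · simp

/-- Hybrid output sequence. -/
def cZ (i : ℕ) (ω : (Fin k1 × Fin k2) × (Fin n → Y1 × Y2)) : Fin n → Y1 ⊕ Y2 :=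
  fun j => if j.val < i then Sum.inl (ω.2 j).1 else Sum.inr (ω.2 j).2

/-- Hybrid output sequence with coordinate `i` removed. -/
def cU (i : Fin n) (ω : (Fin k1 × Fin k2) × (Fin n → Y1 × Y2)) : Fin n → Option (Y1 ⊕ Y2) :=
  fun j => if j = i then none else some (cZ i.val ω j)

/-- Time-shared auxiliary. -/
def cV (a : Fin n × ((Fin k1 × Fin k2) × (Fin n → Y1 × Y2))) :
    Fin n × Fin k1 × (Fin n → Option (Y1 ⊕ Y2)) := (a.1, a.2.1.1, cU a.1 a.2)

lemma cV_markov {B : Type} [Fintype B] (W : X → Y1 × Y2 → ℝ) (hW : IsChannel W)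
    (f : Fin k1 × Fin k2 → Fin n → X) (g : Y1 × Y2 → B) (Wm : X → B → ℝ)
    (hWm : ∀ x b, (∑ u : Y1 × Y2, if g u = b then W x u else 0) = Wm x b) (c a b) :
    Pr (fun a : Fin n × ((Fin k1 × Fin k2) × (Fin n → Y1 × Y2)) => cμ W f a.2 / n)
      (fun ω => ((cV ω, f ω.2.1 ω.1), g (ω.2.2 ω.1))) ((c, a), b)
    = Pr (fun a : Fin n × ((Fin k1 × Fin k2) × (Fin n → Y1 × Y2)) => cμ W f a.2 / n)
      (fun ω => (cV ω, f ω.2.1 ω.1)) (c, a) * Wm a b := by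
  unfold Pr
  conv_lhs => rw [Fintype.sum_prod_type]
  conv_rhs => rw [Fintype.sum_prod_type]
  rw [Finset.sum_mul]
  refine Finset.sum_congr rfl fun i _ => ?_
  conv_lhs => rw [Fintype.sum_prod_type]
  conv_rhs => rw [Fintype.sum_prod_type]
  rw [Finset.sum_mul]
  refine Finset.sum_congr rfl fun m _ => ?_
  let G : (Fin n → Y1 × Y2) → ℝ := fun y =>
    if (cV (i, (m, y)), f m i) = (c, a) then 1 else 0
  have hG : ∀ y y' : Fin n → Y1 × Y2, (∀ j, j ≠ i → y j = y' j) → G y = G y' := by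
    intro y y' h
    have : cV (i, (m, y)) = cV (i, (m, y')) := by
      unfold cV cU cZ
      simp only [Prod.mk.injEq, true_and]
      funext j
      by_cases hj : j = i
      · simp [hj]
      · simp [hj, h j hj]
    simp only [G, this]
  have key := prod_split (fun j => W (f m j)) i (hW _).2 (fun u => if g u = b then 1 else 0) G hG
  simp only [mul_ite, mul_one, mul_zero, hWm] at key
  have e1 : ∀ y : Fin n → Y1 × Y2,
      (if ((cV (i, m, y), f m i), g (y i)) = ((c, a), b) then cμ W f (m, y) / n else 0)
      = 1 / ((k1 : ℝ) * k2) / n *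
        ((∏ j, W (f m j) (y j)) * ((if g (y i) = b then 1 else 0) * G y)) := by
    intro y
    by_cases h1 : cV (i, m, y) = c ∧ f m i = a <;> by_cases h2 : g (y i) = b <;>
      simp [G, h1, h2, cμ]
    ring
  have e2 : ∀ y : Fin n → Y1 × Y2,
      (if (cV (i, m, y), f m i) = (c, a) then cμ W f (m, y) / n else 0)
      = 1 / ((k1 : ℝ) * k2) / n * ((∏ j, W (f m j) (y j)) * G y) := by
    intro y
    by_cases h1 : cV (i, m, y) = c ∧ f m i = a <;>
      simp [G, h1, cμ]
    ring
  simp only [e1, e2]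
  rw [← Finset.mul_sum, ← Finset.mul_sum]
  by_cases hfa : f m i = a
  · have : ∑ y : Fin n → Y1 × Y2, (∏ j, W (f m j) (y j)) * ((if g (y i) = b then 1 else 0) * G y)
        = Wm a b * ∑ y : Fin n → Y1 × Y2, (∏ j, W (f m j) (y j)) * G y := by
      rw [prod_split (fun j => W (f m j)) i (hW _).2 (fun u => if g u = b then 1 else 0) G hG]
      simp only [mul_ite, mul_one, mul_zero, hWm, hfa]
    rw [this]
    ring
  · have : ∀ y, G y = 0 := by
      intro y
      simp [G, hfa]
    simp [this]

lemma errP2_eq (W : X → Y1 × Y2 → ℝ) (f : Fin k1 × Fin k2 → Fin n → X)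
    (g1 : (Fin n → Y1) → Fin k1) (g2 : (Fin n → Y2) × Fin k1 → Fin k2) :
    errP2 W n k1 k2 f g1 g2 = ∑ ω : (Fin k1 × Fin k2) × (Fin n → Y1 × Y2),
      if g1 (fun j => (ω.2 j).1) = ω.1.1 ∧ g2 (fun j => (ω.2 j).2, ω.1.1) = ω.1.2 then 0
      else cμ W f ω := by
  unfold errP2 cμ
  conv_rhs => rw [Fintype.sum_prod_type]
  rw [Finset.mul_sum]
  refine Finset.sum_congr rfl fun m _ => ?_
  rw [Finset.mul_sum, ← (Equiv.arrowProdEquivProdArrow (Fin n) (fun _ => Y1) (fun _ => Y2)).sum_comp]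
  refine Finset.sum_congr rfl fun y _ => ?_
  change 1 / ((k1:ℝ) * k2) * ((∏ t, W (f m t) (y t)) * (if (g1 fun j => (y j).1) = m.1 ∧ g2 (fun j => (y j).2, m.1) = m.2 then 0 else 1)) = _
  by_cases h : (g1 fun c => (y c).1) = m.1 ∧ g2 (fun c => (y c).2, m.1) = m.2
  · rw [if_pos h, if_pos h]; simp
  · rw [if_neg h, if_neg h]; simp

/-- The converse for a single code. -/
lemma converse_code (W : X → Y1 × Y2 → ℝ) (hW : IsChannel W) (hmc : EssMoreCapable W)
    (hn : 0 < n) (h1 : 0 < k1) (h2 : 0 < k2) (f : Fin k1 × Fin k2 → Fin n → X)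
    (g1 : (Fin n → Y1) → Fin k1) (g2 : (Fin n → Y2) × Fin k1 → Fin k2)
    (ε : ℝ) (hε : 0 < ε) (hε1 : ε < 1) (herr : errP2 W n k1 k2 f g1 g2 ≤ ε) :
    ∃ pX : X → ℝ, IsPMF pX ∧
      ((1 - ε) * Real.logb 2 k2 - (-Real.logb 2 (1 - ε) - ε * Real.logb 2 ε)) / n
        ≤ IXY (margW2 W) pX ∧
      ((1 - ε) * (Real.logb 2 k1 + Real.logb 2 k2)
        - 2 * (-Real.logb 2 (1 - ε) - ε * Real.logb 2 ε)) / n ≤ IXY (margW1 W) pX := by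
  have hn' : (0:ℝ) < n := by exact_mod_cast hn
  set η := -Real.logb 2 (1 - ε) - ε * Real.logb 2 ε with hη
  have μ0 := cμ_nonneg W hW f
  have μ1 := cμ_sum W hW f h1 h2
  set μ := cμ W f with hμdef
  let μ' : Fin n × ((Fin k1 × Fin k2) × (Fin n → Y1 × Y2)) → ℝ := fun a => μ a.2 / n
  have μ0' : ∀ a, 0 ≤ μ' a := fun a => div_nonneg (μ0 _) hn'.le
  have μ1' : ∑ a, μ' a = 1 := by
    simp only [μ']
    rw [Fintype.sum_prod_type]
    simp only [← Finset.sum_div, μ1]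
    simp [hn.ne']
  rw [errP2_eq] at herr
  obtain ⟨pX, hpX, b2, b1⟩ := use_mc W hmc (margW1_channel W hW) (margW2_channel W hW) μ' μ0' μ1'
    cV (fun ω => f ω.2.1 ω.1) (fun ω => (ω.2.2 ω.1).1) (fun ω => (ω.2.2 ω.1).2)
    (cV_markov W hW f Prod.fst _ (margW1_eq W)) (cV_markov W hW f Prod.snd _ (margW2_eq W))
  refine ⟨pX, hpX, ?_⟩
  -- Fano
  have F1 := fano μ μ0 μ1 (fun ω => ω.1.1) (fun ω j => (ω.2 j).1) g1 ε hε hε1 (by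
    refine le_trans (Finset.sum_le_sum fun ω _ => ?_) herr
    have := μ0 ω
    split_ifs with a b b <;> first | exact le_rfl | exact this | (exfalso; tauto))
  have F2 := fano μ μ0 μ1 (fun ω => ω.1.2) (fun ω => ((fun j => (ω.2 j).2), ω.1.1)) g2 ε hε hε1 (by
    refine le_trans (Finset.sum_le_sum fun ω _ => ?_) herr
    have := μ0 ω
    split_ifs with a b b <;> first | exact le_rfl | exact this | (exfalso; tauto))
  rw [Fintype.card_fin] at F1 F2
  have HM := cμ_Hrv_MY2 W hW f h1 h2
  rw [← hμdef] at HM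
  rw [Hrv_congr μ (fun ω => (ω.1.2, (fun j => (ω.2 j).2), ω.1.1))
    (fun ω => (ω.1, fun j => (ω.2 j).2))
    (by intro ω ω'; simp only [Prod.ext_iff]; tauto), HM] at F2
  -- hybrids
  let T : ℕ → ℝ := fun i => Hrv μ (fun ω => (ω.1.1, cZ i ω))
  have T0 : T 0 = Hrv μ (fun ω => ((fun j => (ω.2 j).2), ω.1.1)) :=
    Hrv_congr μ _ _ (by intro ω ω'; simp [cZ, funext_iff]; tauto)
  have Tn : T n = Hrv μ (fun ω => (ω.1.1, fun j => (ω.2 j).1)) :=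
    Hrv_congr μ _ _ (by intro ω ω'; simp [cZ, funext_iff])
  have T1 : ∀ i : Fin n, T (i + 1) = Hrv μ (fun ω => (cV (i, ω), (ω.2 i).1)) := by
    intro i
    apply Hrv_congr
    intro ω ω'
    simp only [cV, cU, cZ, Prod.mk.injEq, true_and, funext_iff, and_assoc]
    refine and_congr_right fun _ => ⟨fun h => ⟨fun j => ?_, ?_⟩, fun h j => ?_⟩
    · by_cases hj : j = i
      · simp [hj]
      · have := h j
        have hne : (j:ℕ) ≠ i := fun h => hj (Fin.ext h)
        by_cases hl : (j:ℕ) < i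
        · simpa [hj, hl, Nat.lt_succ_of_lt hl] using this
        · have : ¬ (j:ℕ) < i + 1 := by omega
          simpa [hj, hl, this] using h j
    · simpa using h i
    · by_cases hj : j = i
      · subst hj; simpa using h.2
      · have hne : (j:ℕ) ≠ i := fun h => hj (Fin.ext h)
        by_cases hl : (j:ℕ) < i
        · simpa [hj, hl, Nat.lt_succ_of_lt hl] using h.1 j
        · have : ¬ (j:ℕ) < i + 1 := by omega
          simpa [hj, hl, this] using h.1 j
  have T2 : ∀ i : Fin n, T i = Hrv μ (fun ω => (cV (i, ω), (ω.2 i).2)) := by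
    intro i
    apply Hrv_congr
    intro ω ω'
    simp only [cV, cU, cZ, Prod.mk.injEq, true_and, funext_iff, and_assoc]
    refine and_congr_right fun _ => ⟨fun h => ⟨fun j => ?_, ?_⟩, fun h j => ?_⟩
    · by_cases hj : j = i
      · simp [hj]
      · simpa [hj] using h j
    · simpa using h i
    · by_cases hj : j = i
      · subst hj; simpa using h.2
      · simpa [hj] using h.1 j
  have tele : ∑ i : Fin n, (T i - T (i + 1)) = T 0 - T n := by
    rw [Fin.sum_univ_eq_sum_range (fun i => T i - T (i + 1)) n, Finset.sum_range_sub']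
  have P1 := Hrv_pi μ μ0 μ1 n (fun j ω => (ω.2 j).1)
  have P2 := Hrv_pi μ μ0 μ1 n (fun j ω => (ω.2 j).2)
  have sub := Hrv_subadd μ μ0 μ1 (fun ω j => (ω.2 j).2) (fun ω => ω.1.1)
  -- entropy of M1 at most log k1
  have HM1 : Hrv μ (fun ω => ω.1.1) ≤ Real.logb 2 k1 := by
    have f1 := Hrv_congr μ (fun ω => ω.1.1) (fun ω => (ω.1.1, ())) (by simp)
    have hP : ∀ a, Pr μ (fun ω => ω.1.1) a = 1 / (k1:ℝ) := by
      intro a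
      rw [← sum_Pr_snd μ (fun ω => ω.1.1) (fun ω => ω.1.2) a]
      have : ∀ b, Pr μ (fun ω => (ω.1.1, ω.1.2)) (a, b) = 1 / ((k1:ℝ) * k2) := by
        intro b
        exact cμ_Pr_M W hW f (a, b)
      simp only [this]
      have h2' : (k2:ℝ) ≠ 0 := by positivity
      simp
      field_simp
    unfold Hrv
    simp only [hP]
    rw [← Finset.sum_mul, μ1, one_div, Real.logb_inv]
    simp
  -- time sharing
  have ts1 := Hrv_timeshare μ μ0 μ1 n hn (fun ω => (cV ω, (ω.2.2 ω.1).1))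
    (by intro a b h; simp only [cV, Prod.mk.injEq] at h; exact h.1.1)
  have ts2 := Hrv_timeshare μ μ0 μ1 n hn (fun ω => (cV ω, (ω.2.2 ω.1).2))
    (by intro a b h; simp only [cV, Prod.mk.injEq] at h; exact h.1.1)
  have tsi := Hrv_timeshare μ μ0 μ1 n hn (fun ω => ω.1) (fun a b h => h)
  have tsy1 := Hrv_timeshare μ μ0 μ1 n hn (fun ω => ((ω.2.2 ω.1).1, ω.1))
    (by intro a b h; simp only [Prod.mk.injEq] at h; exact h.2)
  have tsy2 := Hrv_timeshare μ μ0 μ1 n hn (fun ω => ((ω.2.2 ω.1).2, ω.1))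
    (by intro a b h; simp only [Prod.mk.injEq] at h; exact h.2)
  simp only [Hrv_const μ μ1, Finset.sum_const_zero, zero_div, add_zero] at tsi
  have sy1 := Hrv_subadd μ' μ0' μ1' (fun ω => (ω.2.2 ω.1).1) (fun ω => ω.1)
  have sy2 := Hrv_subadd μ' μ0' μ1' (fun ω => (ω.2.2 ω.1).2) (fun ω => ω.1)
  change Hrv μ' _ = _ at ts1 ts2 tsi tsy1 tsy2
  rw [tsi] at sy1 sy2
  rw [tsy1] at sy1
  rw [tsy2] at sy2
  have cy1 : ∀ i : Fin n, Hrv μ (fun ω => ((ω.2 i).1, i)) = Hrv μ (fun ω => (ω.2 i).1) :=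
    fun i => Hrv_congr μ _ _ (by simp)
  have cy2 : ∀ i : Fin n, Hrv μ (fun ω => ((ω.2 i).2, i)) = Hrv μ (fun ω => (ω.2 i).2) :=
    fun i => Hrv_congr μ _ _ (by simp)
  simp only [cy1] at sy1
  simp only [cy2] at sy2
  simp only [← T1] at ts1
  simp only [← T2] at ts2
  rw [ts1, ts2] at b1
  have hsum : ∑ ω, μ' ω * Hent (margW2 W (f ω.2.1 ω.1))
      = (∑ i, ∑ ω, μ ω * Hent (margW2 W (f ω.1 i))) / n := by
    rw [Fintype.sum_prod_type, Finset.sum_div]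
    refine Finset.sum_congr rfl fun i _ => ?_
    rw [Finset.sum_div]
    refine Finset.sum_congr rfl fun ω _ => ?_
    simp only [μ']
    ring
  rw [hsum] at b1 b2
  rw [Finset.sum_sub_distrib] at tele
  set S := ∑ i, ∑ ω, μ ω * Hent (margW2 W (f ω.1 i))
  set A := ∑ i : Fin n, T i
  set B := ∑ i : Fin n, T (i + 1)
  set C1 := ∑ i : Fin n, Hrv μ (fun ω => (ω.2 i).1)
  set C2 := ∑ i : Fin n, Hrv μ (fun ω => (ω.2 i).2)
  constructor
  · refine le_trans ?_ (le_trans (a := (C2 - S) / n) ?_ b2)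
    · apply div_le_div_of_nonneg_right _ hn'.le
      linarith
    · rw [sub_div]; linarith
  · refine le_trans ?_ (le_trans (a := (C1 - B + A - S) / n) ?_ b1)
    · apply div_le_div_of_nonneg_right _ hn'.le
      linarith
    · rw [sub_div, add_div, sub_div]; linarith
end Conv

section OneShot
variable {A B1 B2 : Type} [Fintype A] [Fintype B1] [Fintype B2]

/-- Indicator of a proposition. -/
def ind (p : Prop) : ℝ := if p then 1 else 0

lemma ind_nonneg (p : Prop) : 0 ≤ ind p := by unfold ind; split_ifs <;> norm_num

lemma ind_true {p : Prop} (h : p) : ind p = 1 := by simp [ind, h]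

/-- Pointwise union bound expression. -/
def Ebd {k1 k2 : ℕ} (good1 : A → B1 → Prop) (good2 : A → B2 → Prop)
    (f : Fin k1 × Fin k2 → A) (m : Fin k1 × Fin k2) (y : B1 × B2) : ℝ :=
  (ind (¬ good1 (f m) y.1) + ind (¬ good2 (f m) y.2))
    + (∑ m' ∈ univ.erase m, ind (good1 (f m') y.1)
      + ∑ j ∈ univ.erase m.2, ind (good2 (f (m.1, j)) y.2))

lemma exists_dec {k1 k2 : ℕ} (h1 : 0 < k1) (h2 : 0 < k2)
    (good1 : A → B1 → Prop) (good2 : A → B2 → Prop) (f : Fin k1 × Fin k2 → A) :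
    ∃ (g1 : B1 → Fin k1) (g2 : B2 × Fin k1 → Fin k2), ∀ m y,
      (if g1 y.1 = m.1 ∧ g2 (y.2, m.1) = m.2 then (0:ℝ) else 1) ≤ Ebd good1 good2 f m y := by
  refine ⟨fun y => if h : ∃ m, good1 (f m) y then (Classical.choose h).1 else ⟨0, h1⟩,
    fun y => if h : ∃ j, good2 (f (y.2, j)) y.1 then Classical.choose h else ⟨0, h2⟩, ?_⟩
  intro m y
  have n1 := ind_nonneg (¬ good1 (f m) y.1)
  have n2 := ind_nonneg (¬ good2 (f m) y.2)
  have n3 : 0 ≤ ∑ m' ∈ univ.erase m, ind (good1 (f m') y.1) :=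
    Finset.sum_nonneg fun _ _ => ind_nonneg _
  have n4 : 0 ≤ ∑ j ∈ univ.erase m.2, ind (good2 (f (m.1, j)) y.2) :=
    Finset.sum_nonneg fun _ _ => ind_nonneg _
  unfold Ebd
  split_ifs with h
  · linarith
  by_cases c1 : good1 (f m) y.1
  swap
  · have := ind_true c1; linarith
  by_cases c2 : good2 (f m) y.2
  swap
  · have := ind_true c2; linarith
  have e1 : ∃ m, good1 (f m) y.1 := ⟨m, c1⟩
  have e2 : ∃ j, good2 (f (m.1, j)) y.2 := ⟨m.2, c2⟩
  simp only [e1, e2, dif_pos] at h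
  by_cases d1 : Classical.choose e1 = m
  · have d2 : Classical.choose e2 ≠ m.2 := by
      intro d2
      exact h ⟨by rw [d1], d2⟩
    have := Finset.single_le_sum (f := fun j => ind (good2 (f (m.1, j)) y.2))
      (fun _ _ => ind_nonneg _) (Finset.mem_erase.2 ⟨d2, Finset.mem_univ _⟩)
    simp only [ind_true (Classical.choose_spec e2)] at this
    linarith
  · have := Finset.single_le_sum (f := fun m' => ind (good1 (f m') y.1))
      (fun _ _ => ind_nonneg _) (Finset.mem_erase.2 ⟨d1, Finset.mem_univ _⟩)
    simp only [ind_true (Classical.choose_spec e1)] at this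
    linarith

lemma exists_le_avg {F : Type} [Fintype F] (w v : F → ℝ) (hw : ∀ f, 0 ≤ w f) (h1 : ∑ f, w f = 1)
    (B : ℝ) (h : ∑ f, w f * v f ≤ B) : ∃ f, v f ≤ B := by
  by_contra hc
  push Not at hc
  have : ∃ f, 0 < w f := by
    by_contra h0
    push Not at h0
    have : ∑ f, w f ≤ 0 := Finset.sum_nonpos fun f _ => h0 f
    linarith
  obtain ⟨f0, hf0⟩ := this
  have : ∑ f, w f * B < ∑ f, w f * v f :=
    Finset.sum_lt_sum (fun f _ => mul_le_mul_of_nonneg_left (hc f).le (hw f))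
      ⟨f0, Finset.mem_univ _, mul_lt_mul_of_pos_left (hc f0) hf0⟩
  rw [← Finset.sum_mul, h1] at this
  linarith

lemma cross_avg {M : Type} [Fintype M] [DecidableEq M] (P : A → ℝ) (hP : IsPMF P)
    {B : Type} [Fintype B] (T : A → B → ℝ) (G : A → B → ℝ) (m m' : M) (hm : m' ≠ m) :
    ∑ f : M → A, (∏ j, P (f j)) * ∑ y, T (f m) y * G (f m') y
      = ∑ y, (∑ a, P a * T a y) * ∑ a, P a * G a y := by
  simp only [Finset.mul_sum (s := (univ : Finset B))]
  rw [Finset.sum_comm]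
  refine Finset.sum_congr rfl fun y _ => ?_
  exact prod_marg2 (fun _ : M => P) (fun _ => hP.2) m m' hm (fun a => T a y) (fun a => G a y)

lemma one_shot {k1 k2 : ℕ} (h1 : 0 < k1) (h2 : 0 < k2)
    (P : A → ℝ) (hP : IsPMF P) (T : A → B1 × B2 → ℝ) (hT : IsChannel T)
    (good1 : A → B1 → Prop) (good2 : A → B2 → Prop) (p1 p2 c1 c2 : ℝ)
    (hp1 : ∑ a, P a * ∑ y, T a y * ind (¬ good1 a y.1) ≤ p1)
    (hp2 : ∑ a, P a * ∑ y, T a y * ind (¬ good2 a y.2) ≤ p2)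
    (hc1 : ∑ y, (∑ a, P a * T a y) * ∑ a, P a * ind (good1 a y.1) ≤ c1)
    (hc2 : ∑ y, (∑ a, P a * T a y) * ∑ a, P a * ind (good2 a y.2) ≤ c2) :
    ∃ (f : Fin k1 × Fin k2 → A) (g1 : B1 → Fin k1) (g2 : B2 × Fin k1 → Fin k2),
      (1 : ℝ) / ((k1 : ℝ) * (k2 : ℝ)) *
      ∑ m : Fin k1 × Fin k2, ∑ y,
        T (f m) y * (if g1 y.1 = m.1 ∧ g2 (y.2, m.1) = m.2 then 0 else 1)
      ≤ (p1 + p2) + (((k1 : ℝ) * k2 - 1) * c1 + ((k2 : ℝ) - 1) * c2) := by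
  set Bd := (p1 + p2) + (((k1 : ℝ) * k2 - 1) * c1 + ((k2 : ℝ) - 1) * c2) with hBd
  have hk : (0:ℝ) < (k1:ℝ) * k2 := by positivity
  have key : ∀ m : Fin k1 × Fin k2, ∑ f : Fin k1 × Fin k2 → A, (∏ j, P (f j)) *
      ∑ y, T (f m) y * Ebd good1 good2 f m y ≤ Bd := by
    intro m
    have split : ∀ f : Fin k1 × Fin k2 → A, (∏ j, P (f j)) *
        ∑ y, T (f m) y * Ebd good1 good2 f m y
        = ((∏ j, P (f j)) * ∑ y, T (f m) y * ind (¬ good1 (f m) y.1)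
          + (∏ j, P (f j)) * ∑ y, T (f m) y * ind (¬ good2 (f m) y.2))
        + ((∑ m' ∈ univ.erase m, (∏ j, P (f j)) * ∑ y, T (f m) y * ind (good1 (f m') y.1))
          + ∑ i ∈ univ.erase m.2, (∏ j, P (f j)) *
              ∑ y, T (f m) y * ind (good2 (f (m.1, i)) y.2)) := by
      intro f
      rw [← Finset.mul_sum, ← Finset.mul_sum, ← mul_add, ← mul_add, ← mul_add]
      congr 1
      rw [Finset.sum_comm (s := univ.erase m), Finset.sum_comm (s := univ.erase m.2),
        ← Finset.sum_add_distrib, ← Finset.sum_add_distrib, ← Finset.sum_add_distrib]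
      refine Finset.sum_congr rfl fun y _ => ?_
      rw [← Finset.mul_sum, ← Finset.mul_sum]
      unfold Ebd
      ring
    simp only [split]
    rw [Finset.sum_add_distrib, Finset.sum_add_distrib, Finset.sum_add_distrib]
    have a1 := prod_marg (fun _ : Fin k1 × Fin k2 => P) (fun _ => hP.2) m
      (fun a => ∑ y, T a y * ind (¬ good1 a y.1))
    have a2 := prod_marg (fun _ : Fin k1 × Fin k2 => P) (fun _ => hP.2) m
      (fun a => ∑ y, T a y * ind (¬ good2 a y.2))
    rw [a1, a2, Finset.sum_comm, Finset.sum_comm (t := univ.erase m.2)]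
    refine add_le_add (add_le_add hp1 hp2) (add_le_add ?_ ?_)
    · refine le_trans (Finset.sum_le_card_nsmul _ _ c1 fun m' hm' => ?_) ?_
      · rw [cross_avg P hP T (fun a y => ind (good1 a y.1)) m m' (Finset.ne_of_mem_erase hm')]
        exact hc1
      · rw [Finset.card_erase_of_mem (Finset.mem_univ _), nsmul_eq_mul, Finset.card_univ,
          Fintype.card_prod, Fintype.card_fin, Fintype.card_fin,
          Nat.cast_sub (Nat.succ_le_of_lt (Nat.mul_pos h1 h2))]
        push_cast
        exact le_rfl
    · refine le_trans (Finset.sum_le_card_nsmul _ _ c2 fun i hi => ?_) ?_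
      · rw [cross_avg P hP T (fun a y => ind (good2 a y.2)) m (m.1, i)
          (fun h => Finset.ne_of_mem_erase hi (congrArg Prod.snd h))]
        exact hc2
      · rw [Finset.card_erase_of_mem (Finset.mem_univ _), nsmul_eq_mul, Finset.card_univ,
          Fintype.card_fin, Nat.cast_sub (Nat.succ_le_of_lt h2)]
        push_cast
        exact le_rfl
  obtain ⟨f, hf⟩ := exists_le_avg (fun f : Fin k1 × Fin k2 → A => ∏ j, P (f j))
    (fun f => (1 : ℝ) / ((k1 : ℝ) * (k2 : ℝ)) *
      ∑ m : Fin k1 × Fin k2, ∑ y, T (f m) y * Ebd good1 good2 f m y)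
    (fun f => Finset.prod_nonneg fun j _ => hP.1 _)
    (prod_total (fun _ : Fin k1 × Fin k2 => P) (fun _ => hP.2)) Bd (by
      have : ∀ f : Fin k1 × Fin k2 → A, (∏ j, P (f j)) * ((1 : ℝ) / ((k1 : ℝ) * (k2 : ℝ)) *
          ∑ m : Fin k1 × Fin k2, ∑ y, T (f m) y * Ebd good1 good2 f m y)
          = (1 : ℝ) / ((k1 : ℝ) * (k2 : ℝ)) * ∑ m : Fin k1 × Fin k2, (∏ j, P (f j)) *
            ∑ y, T (f m) y * Ebd good1 good2 f m y := by
        intro f; rw [← Finset.mul_sum]; ring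
      simp only [this]
      rw [← Finset.mul_sum, Finset.sum_comm]
      refine le_trans (mul_le_mul_of_nonneg_left
        (Finset.sum_le_card_nsmul _ _ Bd fun m _ => key m) (by positivity)) ?_
      rw [nsmul_eq_mul, Finset.card_univ, Fintype.card_prod, Fintype.card_fin, Fintype.card_fin]
      push_cast
      rw [← mul_assoc, one_div_mul_cancel hk.ne', one_mul])
  obtain ⟨g1, g2, hg⟩ := exists_dec h1 h2 good1 good2 f
  refine ⟨f, g1, g2, le_trans (mul_le_mul_of_nonneg_left ?_ (by positivity)) hf⟩
  exact Finset.sum_le_sum fun m _ => Finset.sum_le_sum fun y _ =>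
    mul_le_mul_of_nonneg_left (hg m y) ((hT _).1 _)

end OneShot

/-- Chebyshev bound for product pmfs. -/
lemma cheb {U : Type} [Fintype U] (r : U → ℝ) (hr : IsPMF r) (c : U → ℝ)
    (hc : ∑ u, r u * c u = 0) (n : ℕ) (hn : 0 < n) (δ : ℝ) (hδ : 0 < δ) :
    ∑ u : Fin n → U, (∏ j, r (u j)) * ind (∑ j, c (u j) ≤ - (n * δ))
      ≤ (∑ u, r u * c u ^ 2) / (n * δ ^ 2) := by
  have hn' : (0:ℝ) < n := by exact_mod_cast hn
  have second : ∑ u : Fin n → U, (∏ j, r (u j)) * (∑ j, c (u j)) ^ 2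
      = n * ∑ u, r u * c u ^ 2 := by
    have : ∀ u : Fin n → U, (∏ j, r (u j)) * (∑ j, c (u j)) ^ 2
        = ∑ i, ∑ i', (∏ j, r (u j)) * (c (u i) * c (u i')) := by
      intro u
      rw [sq, Finset.sum_mul_sum, Finset.mul_sum]
      exact Finset.sum_congr rfl fun i _ => by rw [Finset.mul_sum]
    simp only [this]
    rw [Finset.sum_comm]
    have : ∀ i : Fin n, ∑ u : Fin n → U, ∑ i', (∏ j, r (u j)) * (c (u i) * c (u i'))
        = ∑ u, r u * c u ^ 2 := by
      intro i
      rw [Finset.sum_comm, Finset.sum_eq_single i]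
      · have := prod_marg (fun _ : Fin n => r) (fun _ => hr.2) i (fun u => c u ^ 2)
        rw [← this]
        exact Finset.sum_congr rfl fun _ _ => by ring
      · intro i' _ h
        rw [prod_marg2 (fun _ : Fin n => r) (fun _ => hr.2) i i' h c c, hc, zero_mul]
      · simp
    simp [this]
  rw [le_div_iff₀ (by positivity)]
  have : (∑ u : Fin n → U, (∏ j, r (u j)) * ind (∑ j, c (u j) ≤ - (n * δ))) * (n * δ) ^ 2
      ≤ n * ∑ u, r u * c u ^ 2 := by
    rw [← second, Finset.sum_mul]
    refine Finset.sum_le_sum fun u _ => ?_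
    rw [mul_assoc]
    refine mul_le_mul_of_nonneg_left ?_ (Finset.prod_nonneg fun j _ => hr.1 _)
    unfold ind
    split_ifs with h
    · have : 0 < n * δ := by positivity
      nlinarith
    · rw [zero_mul]; positivity
  refine le_of_mul_le_mul_left ?_ hn'
  calc _ = (∑ u : Fin n → U, (∏ j, r (u j)) * ind (∑ j, c (u j) ≤ - (n * δ))) * (n * δ) ^ 2 := by
        ring
    _ ≤ _ := this

section Block
variable {X Y : Type} [Fintype X] [Fintype Y]

/-- Output law. -/
def Qd (Wm : X → Y → ℝ) (pX : X → ℝ) (y : Y) : ℝ := ∑ x, pX x * Wm x y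

lemma IXY_density (Wm : X → Y → ℝ) (hW : IsChannel Wm) (pX : X → ℝ) (hp : IsPMF pX) :
    ∑ u : X × Y, pX u.1 * Wm u.1 u.2 * Real.logb 2 (Wm u.1 u.2 / Qd Wm pX u.2) = IXY Wm pX := by
  have e : ∀ u : X × Y, pX u.1 * Wm u.1 u.2 * Real.logb 2 (Wm u.1 u.2 / Qd Wm pX u.2)
      = pX u.1 * Wm u.1 u.2 * Real.logb 2 (pX u.1 * Wm u.1 u.2)
        - pX u.1 * Wm u.1 u.2 * Real.logb 2 (pX u.1)
        - pX u.1 * Wm u.1 u.2 * Real.logb 2 (Qd Wm pX u.2) := by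
    intro u
    by_cases h : pX u.1 * Wm u.1 u.2 = 0
    · simp [h]
    · have h1 : pX u.1 ≠ 0 := left_ne_zero_of_mul h
      have h2 : Wm u.1 u.2 ≠ 0 := right_ne_zero_of_mul h
      have h3 : Qd Wm pX u.2 ≠ 0 := by
        have n0 : ∀ x, 0 ≤ pX x * Wm x u.2 := fun x => mul_nonneg (hp.1 x) ((hW x).1 _)
        have : 0 < Qd Wm pX u.2 := by
          refine lt_of_lt_of_le (lt_of_le_of_ne (n0 u.1) (Ne.symm h)) ?_
          exact Finset.single_le_sum (f := fun x => pX x * Wm x u.2) (fun x _ => n0 x)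
            (Finset.mem_univ u.1)
        exact this.ne'
      rw [Real.logb_div h2 h3, Real.logb_mul h1 h2]
      ring
  simp only [e, Finset.sum_sub_distrib]
  unfold IXY MI Hent
  have a1 : ∑ u : X × Y, pX u.1 * Wm u.1 u.2 * Real.logb 2 (pX u.1)
      = ∑ a, (∑ b, pX a * Wm a b) * Real.logb 2 (∑ b, pX a * Wm a b) := by
    rw [Fintype.sum_prod_type]
    refine Finset.sum_congr rfl fun a _ => ?_
    dsimp only
    rw [← Finset.sum_mul]
    simp only [← Finset.mul_sum, (hW a).2, mul_one]
  have a2 : ∑ u : X × Y, pX u.1 * Wm u.1 u.2 * Real.logb 2 (Qd Wm pX u.2)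
      = ∑ b, (∑ a, pX a * Wm a b) * Real.logb 2 (∑ a, pX a * Wm a b) := by
    rw [Fintype.sum_prod_type_right]
    refine Finset.sum_congr rfl fun b _ => ?_
    dsimp only
    rw [← Finset.sum_mul]
    rfl
  rw [a1, a2]
  ring

/-- Threshold test. -/
def goodn (Wm : X → Y → ℝ) (pX : X → ℝ) {n : ℕ} (γ : ℝ) (x : Fin n → X) (y : Fin n → Y) : Prop :=
  (2:ℝ) ^ γ * ∏ j, Qd Wm pX (y j) < ∏ j, Wm (x j) (y j)

lemma r_pmf (Wm : X → Y → ℝ) (hW : IsChannel Wm) (pX : X → ℝ) (hp : IsPMF pX) :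
    IsPMF (fun u : X × Y => pX u.1 * Wm u.1 u.2) := by
  refine ⟨fun u => mul_nonneg (hp.1 _) ((hW _).1 _), ?_⟩
  rw [Fintype.sum_prod_type]
  simp only [← Finset.mul_sum, (hW _).2, mul_one, hp.2]

/-- Information variance. -/
def Vd (Wm : X → Y → ℝ) (pX : X → ℝ) : ℝ :=
  ∑ u : X × Y, pX u.1 * Wm u.1 u.2 *
    (Real.logb 2 (Wm u.1 u.2 / Qd Wm pX u.2) - IXY Wm pX) ^ 2

lemma typ_bound (Wm : X → Y → ℝ) (hW : IsChannel Wm) (pX : X → ℝ) (hp : IsPMF pX)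
    (n : ℕ) (hn : 0 < n) (δ : ℝ) (hδ : 0 < δ) :
    ∑ x : Fin n → X, (∏ j, pX (x j)) * ∑ y : Fin n → Y, (∏ j, Wm (x j) (y j)) *
      ind (¬ goodn Wm pX (n * (IXY Wm pX - δ)) x y) ≤ Vd Wm pX / (n * δ ^ 2) := by
  have hr := r_pmf Wm hW pX hp
  have ch := cheb (fun u : X × Y => pX u.1 * Wm u.1 u.2) hr
    (fun u => Real.logb 2 (Wm u.1 u.2 / Qd Wm pX u.2) - IXY Wm pX) (by
      simp only [mul_sub, Finset.sum_sub_distrib]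
      rw [IXY_density Wm hW pX hp, ← Finset.sum_mul, hr.2]
      ring) n hn δ hδ
  refine le_trans ?_ ch
  rw [← (Equiv.arrowProdEquivProdArrow (Fin n) (fun _ => X) (fun _ => Y)).symm.sum_comp,
    Fintype.sum_prod_type]
  refine Finset.sum_le_sum fun x _ => ?_
  rw [Finset.mul_sum]
  refine Finset.sum_le_sum fun y _ => ?_
  change _ ≤ (∏ j, pX (x j) * Wm (x j) (y j)) *
    ind (∑ j, (Real.logb 2 (Wm (x j) (y j) / Qd Wm pX (y j)) - IXY Wm pX) ≤ - (n * δ))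
  rw [← mul_assoc, ← Finset.prod_mul_distrib]
  by_cases h0 : ∏ j, pX (x j) * Wm (x j) (y j) = 0
  · simp [h0]
  have hpos : ∀ j, 0 < pX (x j) * Wm (x j) (y j) := fun j =>
    lt_of_le_of_ne (mul_nonneg (hp.1 _) ((hW _).1 _))
      (Ne.symm (Finset.prod_ne_zero_iff.1 h0 j (Finset.mem_univ _)))
  refine mul_le_mul_of_nonneg_left ?_ (Finset.prod_nonneg fun j _ => (hpos j).le)
  by_cases hg : goodn Wm pX (n * (IXY Wm pX - δ)) x y
  · have : ind (¬ goodn Wm pX (n * (IXY Wm pX - δ)) x y) = 0 := by simp [ind, hg]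
    rw [this]; exact ind_nonneg _
  rw [ind_true hg, ind_true]
  unfold goodn at hg
  push Not at hg
  have hQ : ∀ j, 0 < Qd Wm pX (y j) := fun j => by
    refine lt_of_lt_of_le (hpos j) ?_
    exact Finset.single_le_sum (f := fun a => pX a * Wm a (y j))
      (fun a _ => mul_nonneg (hp.1 _) ((hW _).1 _)) (Finset.mem_univ (x j))
  have hWp : ∀ j, 0 < Wm (x j) (y j) := fun j => pos_of_mul_pos_right (hpos j) (hp.1 _)
  have hQP : 0 < ∏ j, Qd Wm pX (y j) := Finset.prod_pos fun j _ => hQ j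
  rw [← div_le_iff₀ hQP, ← Finset.prod_div_distrib] at hg
  have := Real.logb_le_logb_of_le (b := 2) (by norm_num)
    (Finset.prod_pos fun j _ => div_pos (hWp j) (hQ j)) hg
  rw [Real.logb_rpow (by norm_num) (by norm_num),
    Real.logb_prod _ _ (fun j _ => (div_pos (hWp j) (hQ j)).ne')] at this
  rw [Finset.sum_sub_distrib]
  simp only [Finset.sum_const, Finset.card_univ, Fintype.card_fin, nsmul_eq_mul]
  linarith

lemma cross_bound (Wm : X → Y → ℝ) (hW : IsChannel Wm) (pX : X → ℝ) (hp : IsPMF pX)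
    (n : ℕ) (γ : ℝ) :
    ∑ y : Fin n → Y, (∏ j, Qd Wm pX (y j)) * ∑ x : Fin n → X, (∏ j, pX (x j)) *
      ind (goodn Wm pX γ x y) ≤ (2:ℝ) ^ (-γ) := by
  have h2 : (0:ℝ) < 2 ^ γ := by positivity
  have hx : ∀ x : Fin n → X, ∑ y : Fin n → Y, (∏ j, Qd Wm pX (y j)) * ind (goodn Wm pX γ x y)
      ≤ (2:ℝ) ^ (-γ) := by
    intro x
    have : ∑ y : Fin n → Y, (∏ j, Wm (x j) (y j)) = 1 :=
      prod_total (fun j => Wm (x j)) (fun j => (hW _).2)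
    calc _ ≤ ∑ y : Fin n → Y, (2:ℝ) ^ (-γ) * (∏ j, Wm (x j) (y j)) := by
          refine Finset.sum_le_sum fun y _ => ?_
          have hWn : 0 ≤ ∏ j, Wm (x j) (y j) := Finset.prod_nonneg fun j _ => (hW _).1 _
          unfold ind
          split_ifs with h
          · unfold goodn at h
            rw [Real.rpow_neg (by norm_num), mul_one, ← div_eq_inv_mul, le_div_iff₀ h2]
            linarith
          · rw [mul_zero]; positivity
      _ = _ := by rw [← Finset.mul_sum, this, mul_one]
  have e : ∑ y : Fin n → Y, (∏ j, Qd Wm pX (y j)) * ∑ x : Fin n → X, (∏ j, pX (x j)) *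
      ind (goodn Wm pX γ x y)
      = ∑ x : Fin n → X, (∏ j, pX (x j)) * ∑ y : Fin n → Y, (∏ j, Qd Wm pX (y j)) *
        ind (goodn Wm pX γ x y) := by
    simp only [Finset.mul_sum]
    rw [Finset.sum_comm]
    exact Finset.sum_congr rfl fun x _ => Finset.sum_congr rfl fun y _ => by ring
  rw [e]
  calc _ ≤ ∑ x : Fin n → X, (∏ j, pX (x j)) * (2:ℝ) ^ (-γ) :=
        Finset.sum_le_sum fun x _ => mul_le_mul_of_nonneg_left (hx x)
          (Finset.prod_nonneg fun j _ => hp.1 _)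
    _ = _ := by rw [← Finset.sum_mul, prod_total (fun _ => pX) (fun _ => hp.2), one_mul]

end Block

section BC
variable {X Y1 Y2 : Type} [Fintype X] [Fintype Y1] [Fintype Y2]

lemma sum_prod_pi {Y : Type} [Fintype Y] {n : ℕ} (w : Fin n → Y → ℝ) :
    ∑ y : Fin n → Y, ∏ t, w t (y t) = ∏ t, ∑ a, w t a := by
  rw [Finset.prod_univ_sum (fun _ : Fin n => (Finset.univ : Finset Y)), Fintype.piFinset_univ]

lemma nFold_marg1 (W : X → Y1 × Y2 → ℝ) (n : ℕ) (x : Fin n → X) (F : (Fin n → Y1) → ℝ) :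
    ∑ y, nFold W n x y * F y.1 = ∑ y : Fin n → Y1, (∏ j, margW1 W (x j) (y j)) * F y := by
  rw [Fintype.sum_prod_type]
  refine Finset.sum_congr rfl fun y _ => ?_
  dsimp only
  rw [← Finset.sum_mul]
  congr 1
  exact sum_prod_pi (fun t b => W (x t) (y t, b))

lemma nFold_marg2 (W : X → Y1 × Y2 → ℝ) (n : ℕ) (x : Fin n → X) (F : (Fin n → Y2) → ℝ) :
    ∑ y, nFold W n x y * F y.2 = ∑ y : Fin n → Y2, (∏ j, margW2 W (x j) (y j)) * F y := by
  rw [Fintype.sum_prod_type_right]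
  refine Finset.sum_congr rfl fun y _ => ?_
  dsimp only
  rw [← Finset.sum_mul]
  congr 1
  exact sum_prod_pi (fun t b => W (x t) (b, y t))

lemma nFold_channel (W : X → Y1 × Y2 → ℝ) (hW : IsChannel W) (n : ℕ) :
    IsChannel (nFold W n) := by
  intro x
  refine ⟨fun y => Finset.prod_nonneg fun j _ => (hW _).1 _, ?_⟩
  have := nFold_marg1 W n x (fun _ => 1)
  simp only [mul_one] at this
  rw [this]
  exact prod_total (fun j => margW1 W (x j)) (fun j => (margW1_channel W hW _).2)

lemma Qn_eq {Y : Type} [Fintype Y] (Wm : X → Y → ℝ) (pX : X → ℝ) (n : ℕ) (y : Fin n → Y) :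
    ∏ j, Qd Wm pX (y j) = ∑ x : Fin n → X, (∏ j, pX (x j)) * ∏ j, Wm (x j) (y j) := by
  unfold Qd
  rw [← sum_prod_pi (fun t a => pX a * Wm a (y t))]
  simp only [Finset.prod_mul_distrib]

lemma random_code (W : X → Y1 × Y2 → ℝ) (hW : IsChannel W) (pX : X → ℝ) (hp : IsPMF pX)
    (n k1 k2 : ℕ) (hn : 0 < n) (h1 : 0 < k1) (h2 : 0 < k2) (δ : ℝ) (hδ : 0 < δ) :
    ∃ (f : Fin k1 × Fin k2 → Fin n → X) (g1 : (Fin n → Y1) → Fin k1)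
        (g2 : (Fin n → Y2) × Fin k1 → Fin k2),
      errP2 W n k1 k2 f g1 g2 ≤
      (Vd (margW1 W) pX / (n * δ ^ 2) + Vd (margW2 W) pX / (n * δ ^ 2))
      + (((k1:ℝ) * k2 - 1) * (2:ℝ) ^ (-(n * (IXY (margW1 W) pX - δ)))
        + ((k2:ℝ) - 1) * (2:ℝ) ^ (-(n * (IXY (margW2 W) pX - δ)))) := by
  have m1 := margW1_channel W hW
  have m2 := margW2_channel W hW
  refine one_shot h1 h2 (fun x : Fin n → X => ∏ j, pX (x j))
    ⟨fun x => Finset.prod_nonneg fun j _ => hp.1 _, prod_total (fun _ => pX) (fun _ => hp.2)⟩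
    (nFold W n) (nFold_channel W hW n)
    (goodn (margW1 W) pX (n * (IXY (margW1 W) pX - δ)))
    (goodn (margW2 W) pX (n * (IXY (margW2 W) pX - δ))) _ _ _ _ ?_ ?_ ?_ ?_
  · refine le_trans (le_of_eq ?_) (typ_bound (margW1 W) m1 pX hp n hn δ hδ)
    refine Finset.sum_congr rfl fun x _ => ?_
    congr 1
    exact nFold_marg1 W n x (fun y => ind (¬ goodn (margW1 W) pX _ x y))
  · refine le_trans (le_of_eq ?_) (typ_bound (margW2 W) m2 pX hp n hn δ hδ)
    refine Finset.sum_congr rfl fun x _ => ?_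
    congr 1
    exact nFold_marg2 W n x (fun y => ind (¬ goodn (margW2 W) pX _ x y))
  · refine le_trans (le_of_eq ?_) (cross_bound (margW1 W) m1 pX hp n _)
    simp only [Qn_eq, Finset.sum_mul (s := (univ : Finset (Fin n → X)))]
    rw [Finset.sum_comm, Finset.sum_comm (s := (univ : Finset (Fin n → Y1)))]
    refine Finset.sum_congr rfl fun x _ => ?_
    simp only [mul_assoc, ← Finset.mul_sum (s := (univ : Finset (Fin n → Y1))),
      ← Finset.mul_sum (s := (univ : Finset ((Fin n → Y1) × (Fin n → Y2))))]
    congr 1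
    exact nFold_marg1 W n x (fun y => ∑ x : Fin n → X, (∏ j, pX (x j)) *
      ind (goodn (margW1 W) pX _ x y))
  · refine le_trans (le_of_eq ?_) (cross_bound (margW2 W) m2 pX hp n _)
    simp only [Qn_eq, Finset.sum_mul (s := (univ : Finset (Fin n → X)))]
    rw [Finset.sum_comm, Finset.sum_comm (s := (univ : Finset (Fin n → Y2)))]
    refine Finset.sum_congr rfl fun x _ => ?_
    simp only [mul_assoc, ← Finset.mul_sum (s := (univ : Finset (Fin n → Y2))),
      ← Finset.mul_sum (s := (univ : Finset ((Fin n → Y1) × (Fin n → Y2))))]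
    congr 1
    exact nFold_marg2 W n x (fun y => ∑ x : Fin n → X, (∏ j, pX (x j)) *
      ind (goodn (margW2 W) pX _ x y))

end BC

section Fin
variable {X Y1 Y2 : Type} [Fintype X] [Fintype Y1] [Fintype Y2]

lemma err_tendsto (V δ : ℝ) (hδ : 0 < δ) :
    Filter.Tendsto (fun n : ℕ => V / (n * δ ^ 2) + 5 * (2:ℝ) ^ (-(n * δ)))
      Filter.atTop (nhds 0) := by
  have a : Filter.Tendsto (fun n : ℕ => V / (n * δ ^ 2)) Filter.atTop (nhds 0) := by
    have := (tendsto_const_div_atTop_nhds_zero_nat (V / δ ^ 2))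
    refine this.congr fun n => ?_
    rw [div_div, mul_comm]
  have b : Filter.Tendsto (fun n : ℕ => 5 * (2:ℝ) ^ (-(n * δ))) Filter.atTop (nhds 0) := by
    have h1 : (2:ℝ) ^ (-δ) < 1 := Real.rpow_lt_one_of_one_lt_of_neg (by norm_num) (by linarith)
    have := (tendsto_pow_atTop_nhds_zero_of_lt_one (by positivity : (0:ℝ) ≤ 2 ^ (-δ)) h1).const_mul 5
    rw [mul_zero] at this
    refine this.congr fun n => ?_
    rw [← Real.rpow_natCast, ← Real.rpow_mul (by norm_num)]
    congr 2
    ring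
  simpa using a.add b

lemma ach_of_lt (W : X → Y1 × Y2 → ℝ) (hW : IsChannel W) (pX : X → ℝ) (hp : IsPMF pX)
    (R : ℝ × ℝ) (h1 : 0 ≤ R.1) (h2 : 0 ≤ R.2)
    (hR2 : R.2 = 0 ∨ R.2 < IXY (margW2 W) pX)
    (hR1 : R.1 + R.2 = 0 ∨ R.1 + R.2 < IXY (margW1 W) pX) : Ach2 W R := by
  refine ⟨h1, h2, fun ε hε => ?_⟩
  have e2 : ∃ δ > 0, R.2 = 0 ∨ R.2 + 2 * δ ≤ IXY (margW2 W) pX := by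
    rcases hR2 with h | h
    · exact ⟨1, one_pos, Or.inl h⟩
    · exact ⟨(IXY (margW2 W) pX - R.2) / 2, by linarith, Or.inr (by linarith)⟩
  have e1 : ∃ δ > 0, R.1 + R.2 = 0 ∨ R.1 + R.2 + 2 * δ ≤ IXY (margW1 W) pX := by
    rcases hR1 with h | h
    · exact ⟨1, one_pos, Or.inl h⟩
    · exact ⟨(IXY (margW1 W) pX - (R.1 + R.2)) / 2, by linarith, Or.inr (by linarith)⟩
  obtain ⟨d2, hd2, e2⟩ := e2
  obtain ⟨d1, hd1, e1⟩ := e1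
  set δ := min d1 d2 with hδdef
  have hδ : 0 < δ := lt_min hd1 hd2
  have l1 : δ ≤ d1 := min_le_left _ _
  have l2 : δ ≤ d2 := min_le_right _ _
  have ev := (err_tendsto (Vd (margW1 W) pX + Vd (margW2 W) pX) δ hδ).eventually
    (gt_mem_nhds hε)
  obtain ⟨n, hn, hn0⟩ := (ev.and (Filter.eventually_gt_atTop 0)).exists
  have hn' : (0:ℝ) < n := by exact_mod_cast hn0
  have ceil_ge : ∀ r : ℝ, (2:ℝ) ^ (n * r) ≤ (⌈(2:ℝ) ^ (n * r)⌉₊ : ℝ) := fun r => Nat.le_ceil _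
  have ceil_pos : ∀ r : ℝ, 0 < ⌈(2:ℝ) ^ (n * r)⌉₊ := fun r => Nat.ceil_pos.2 (by positivity)
  have ceil_lt : ∀ r : ℝ, (⌈(2:ℝ) ^ (n * r)⌉₊ : ℝ) < (2:ℝ) ^ (n * r) + 1 :=
    fun r => Nat.ceil_lt_add_one (by positivity)
  have rate : ∀ r : ℝ, r ≤ Real.logb 2 (⌈(2:ℝ) ^ (n * r)⌉₊ : ℝ) / n := by
    intro r
    rw [le_div_iff₀ hn', Real.le_logb_iff_rpow_le (by norm_num) (by exact_mod_cast ceil_pos r),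
      mul_comm]
    exact ceil_ge r
  set k1 := ⌈(2:ℝ) ^ (n * R.1)⌉₊ with hk1
  set k2 := ⌈(2:ℝ) ^ (n * R.2)⌉₊ with hk2
  obtain ⟨f, g1, g2, hfg⟩ := random_code W hW pX hp n k1 k2 hn0 (ceil_pos _) (ceil_pos _) δ hδ
  refine ⟨n, k1, k2, hn0, ceil_pos _, ceil_pos _, f, g1, g2, rate _, rate _,
    le_trans hfg (le_trans ?_ hn.le)⟩
  have hone : ∀ r : ℝ, 0 ≤ r → (1:ℝ) ≤ (2:ℝ) ^ (n * r) := fun r hr =>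
    Real.one_le_rpow (by norm_num) (by positivity)
  have hpd : (0:ℝ) < (2:ℝ) ^ (-(n * δ)) := by positivity
  have t2 : ((k2:ℝ) - 1) * (2:ℝ) ^ (-(n * (IXY (margW2 W) pX - δ))) ≤ (2:ℝ) ^ (-(n * δ)) := by
    rcases e2 with h | h
    · have : k2 = 1 := by rw [hk2, h]; simp
      rw [this]
      simpa using hpd.le
    · calc _ ≤ (2:ℝ) ^ (n * R.2) * (2:ℝ) ^ (-(n * (IXY (margW2 W) pX - δ))) := by
            refine mul_le_mul_of_nonneg_right ?_ (by positivity)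
            linarith [ceil_lt R.2]
        _ = (2:ℝ) ^ (n * R.2 + -(n * (IXY (margW2 W) pX - δ))) :=
            (Real.rpow_add (by norm_num) _ _).symm
        _ ≤ _ := by
            refine Real.rpow_le_rpow_of_exponent_le (by norm_num) ?_
            nlinarith
  have t1 : ((k1:ℝ) * k2 - 1) * (2:ℝ) ^ (-(n * (IXY (margW1 W) pX - δ)))
      ≤ 4 * (2:ℝ) ^ (-(n * δ)) := by
    rcases e1 with h | h
    · have r1 : R.1 = 0 := by linarith
      have r2 : R.2 = 0 := by linarith
      have a1 : k1 = 1 := by rw [hk1, r1]; simp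
      have a2 : k2 = 1 := by rw [hk2, r2]; simp
      rw [a1, a2]
      simpa using hpd.le
    · have b1 : (k1:ℝ) ≤ 2 * (2:ℝ) ^ (n * R.1) := by linarith [ceil_lt R.1, hone R.1 h1]
      have b2 : (k2:ℝ) ≤ 2 * (2:ℝ) ^ (n * R.2) := by linarith [ceil_lt R.2, hone R.2 h2]
      calc _ ≤ ((2 * (2:ℝ) ^ (n * R.1)) * (2 * (2:ℝ) ^ (n * R.2)))
              * (2:ℝ) ^ (-(n * (IXY (margW1 W) pX - δ))) := by
            refine mul_le_mul_of_nonneg_right ?_ (by positivity)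
            have := mul_le_mul b1 b2 (by positivity) (by positivity)
            linarith
        _ = 4 * (2:ℝ) ^ (n * R.1 + n * R.2 + -(n * (IXY (margW1 W) pX - δ))) := by
            rw [Real.rpow_add (by norm_num), Real.rpow_add (by norm_num)]
            ring
        _ ≤ _ := by
            refine mul_le_mul_of_nonneg_left ?_ (by norm_num)
            refine Real.rpow_le_rpow_of_exponent_le (by norm_num) ?_
            nlinarith
  rw [← add_div]
  linarith

lemma cont_xlogx : Continuous (fun x : ℝ => x * Real.logb 2 x) := by
  have : (fun x : ℝ => x * Real.logb 2 x) = fun x => x * Real.log x / Real.log 2 := by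
    funext x; rw [Real.logb, mul_div_assoc]
  rw [this]
  exact Real.continuous_mul_log.div_const _

lemma cont_Hent {α β : Type} [Fintype α] [TopologicalSpace β] (g : β → α → ℝ)
    (hg : ∀ a, Continuous fun b => g b a) : Continuous fun b => Hent (g b) := by
  unfold Hent
  exact (continuous_finsetSum _ fun a _ => cont_xlogx.comp (hg a)).neg

lemma cont_IXY {Y : Type} [Fintype Y] (Wm : X → Y → ℝ) : Continuous fun pX => IXY Wm pX := by
  unfold IXY MI
  refine ((cont_Hent _ fun a => ?_).add (cont_Hent _ fun b => ?_)).sub (cont_Hent _ fun u => ?_)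
  all_goals fun_prop

lemma eta_tendsto (r : ℝ) : Filter.Tendsto
    (fun ε : ℝ => ε * r + 2 * (-Real.logb 2 (1 - ε) - ε * Real.logb 2 ε))
    (nhdsWithin 0 (Set.Ioi 0)) (nhds 0) := by
  have c : ContinuousAt
      (fun ε : ℝ => ε * r + 2 * (-Real.logb 2 (1 - ε) - ε * Real.logb 2 ε)) 0 := by
    have h1 : ContinuousAt (fun ε : ℝ => Real.logb 2 (1 - ε)) 0 := by
      unfold Real.logb
      refine ContinuousAt.div_const ?_ _
      refine ContinuousAt.log ?_ (by norm_num)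
      fun_prop
    have h2 : ContinuousAt (fun ε : ℝ => ε * Real.logb 2 ε) 0 := cont_xlogx.continuousAt
    exact (continuousAt_id.mul continuousAt_const).add (continuousAt_const.mul (h1.neg.sub h2))
  have := c.tendsto.mono_left (nhdsWithin_le_nhds (s := Set.Ioi (0:ℝ)))
  simpa using this

lemma conv_approx (W : X → Y1 × Y2 → ℝ) (hW : IsChannel W) (hmc : EssMoreCapable W)
    (R : ℝ × ℝ) (hR : Ach2 W R) (δ : ℝ) (hδ : 0 < δ) :
    ∃ pX : X → ℝ, IsPMF pX ∧ R.2 - δ ≤ IXY (margW2 W) pX ∧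
      R.1 + R.2 - δ ≤ IXY (margW1 W) pX := by
  obtain ⟨hR1, hR2, hA⟩ := hR
  have ev := (eta_tendsto (R.1 + R.2)).eventually (gt_mem_nhds hδ)
  have ev1 : ∀ᶠ ε : ℝ in nhdsWithin 0 (Set.Ioi 0), ε < 1 :=
    nhdsWithin_le_nhds (gt_mem_nhds one_pos)
  obtain ⟨ε, ⟨hε, hε1⟩, hε0⟩ := ((ev.and ev1).and self_mem_nhdsWithin).exists
  replace hε0 : 0 < ε := hε0
  obtain ⟨n, k1, k2, hn, h1, h2, f, g1, g2, r1, r2, herr⟩ := hA ε hε0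
  obtain ⟨pX, hp, b2, b1⟩ := converse_code W hW hmc hn h1 h2 f g1 g2 ε hε0 hε1 herr
  have l1 : Real.logb 2 (1 - ε) ≤ 0 :=
    Real.logb_nonpos (by norm_num) (by linarith) (by linarith)
  have l2 : ε * Real.logb 2 ε ≤ 0 :=
    mul_nonpos_of_nonneg_of_nonpos hε0.le
      (Real.logb_nonpos (by norm_num) hε0.le hε1.le)
  set η := -Real.logb 2 (1 - ε) - ε * Real.logb 2 ε with hη
  have hη0 : 0 ≤ η := by linarith
  have hn1 : (1:ℝ) ≤ n := by exact_mod_cast hn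
  have hηn : η / n ≤ η := div_le_self hη0 hn1
  refine ⟨pX, hp, le_trans ?_ b2, le_trans ?_ b1⟩
  · have : ((1 - ε) * Real.logb 2 k2 - η) / n = (1 - ε) * (Real.logb 2 k2 / n) - η / n := by ring
    rw [this]
    have := mul_le_mul_of_nonneg_left r2 (by linarith : 0 ≤ 1 - ε)
    nlinarith
  · have : ((1 - ε) * (Real.logb 2 k1 + Real.logb 2 k2) - 2 * η) / n
        = (1 - ε) * (Real.logb 2 k1 / n + Real.logb 2 k2 / n) - 2 * (η / n) := by ring
    rw [this]
    have := mul_le_mul_of_nonneg_left (add_le_add r1 r2) (by linarith : 0 ≤ 1 - ε)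
    nlinarith

lemma conv_closure (W : X → Y1 × Y2 → ℝ) (hW : IsChannel W) (hmc : EssMoreCapable W)
    (R : ℝ × ℝ) (hR : R ∈ Cap2 W) : 0 ≤ R.1 ∧ 0 ≤ R.2 ∧ ∃ pX : X → ℝ, IsPMF pX ∧
      R.2 ≤ IXY (margW2 W) pX ∧ R.1 + R.2 ≤ IXY (margW1 W) pX := by
  unfold Cap2 at hR
  obtain ⟨s, hs, hlim⟩ := mem_closure_iff_seq_limit.1 hR
  have lim1 : Filter.Tendsto (fun k => (s k).1) Filter.atTop (nhds R.1) :=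
    (continuous_fst.tendsto R).comp hlim
  have lim2 : Filter.Tendsto (fun k => (s k).2) Filter.atTop (nhds R.2) :=
    (continuous_snd.tendsto R).comp hlim
  refine ⟨ge_of_tendsto' lim1 fun k => (hs k).1, ge_of_tendsto' lim2 fun k => (hs k).2.1, ?_⟩
  have hd : ∀ k : ℕ, (0:ℝ) < 1 / ((k:ℝ) + 1) := fun k => by positivity
  choose p hp a2 a1 using fun k : ℕ => conv_approx W hW hmc (s k) (hs k) (1 / ((k:ℝ) + 1)) (hd k)
  obtain ⟨q, hq, φ, hφ, hqlim⟩ := (isCompact_stdSimplex ℝ X).tendsto_subseq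
    (x := p) (fun k => ⟨(hp k).1, (hp k).2⟩)
  have d0 : Filter.Tendsto (fun k : ℕ => 1 / ((k:ℝ) + 1)) Filter.atTop (nhds 0) :=
    tendsto_one_div_add_atTop_nhds_zero_nat
  refine ⟨q, ⟨hq.1, hq.2⟩, ?_, ?_⟩
  · have L := (lim2.sub d0).comp hφ.tendsto_atTop
    rw [sub_zero] at L
    exact le_of_tendsto_of_tendsto' L (((cont_IXY (margW2 W)).tendsto q).comp hqlim)
      fun k => a2 (φ k)
  · have L := ((lim1.add lim2).sub d0).comp hφ.tendsto_atTop
    rw [sub_zero] at L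
    exact le_of_tendsto_of_tendsto' L (((cont_IXY (margW1 W)).tendsto q).comp hqlim)
      fun k => a1 (φ k)

lemma ach_closure (W : X → Y1 × Y2 → ℝ) (hW : IsChannel W)
    (R : ℝ × ℝ) (h1 : 0 ≤ R.1) (h2 : 0 ≤ R.2) (pX : X → ℝ) (hp : IsPMF pX)
    (b2 : R.2 ≤ IXY (margW2 W) pX) (b1 : R.1 + R.2 ≤ IXY (margW1 W) pX) : R ∈ Cap2 W := by
  unfold Cap2
  have hd : ∀ k : ℕ, (0:ℝ) < 1 / ((k:ℝ) + 1) := fun k => by positivity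
  have hd1 : ∀ k : ℕ, 1 / ((k:ℝ) + 1) ≤ 1 := fun k => by
    rw [div_le_one (by positivity)]
    have : (0:ℝ) ≤ k := by positivity
    linarith
  refine mem_closure_iff_seq_limit.2
    ⟨fun k => ((1 - 1 / ((k:ℝ) + 1)) * R.1, (1 - 1 / ((k:ℝ) + 1)) * R.2), fun k => ?_, ?_⟩
  · have hdk := hd k
    have hdk1 := hd1 k
    set t := 1 / ((k:ℝ) + 1)
    refine ach_of_lt W hW pX hp _ (mul_nonneg (by linarith) h1) (mul_nonneg (by linarith) h2)
      ?_ ?_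
    · rcases h2.eq_or_lt with h | h
      · left; simp [← h]
      · right
        have := mul_pos hdk h
        show (1 - t) * R.2 < _
        linarith
    · rcases (add_nonneg h1 h2).eq_or_lt with h | h
      · left
        show (1 - t) * R.1 + (1 - t) * R.2 = 0
        rw [← mul_add, ← h, mul_zero]
      · right
        have := mul_pos hdk h
        show (1 - t) * R.1 + (1 - t) * R.2 < _
        linarith
  · have d0 : Filter.Tendsto (fun k : ℕ => 1 - 1 / ((k:ℝ) + 1)) Filter.atTop (nhds 1) := by
      simpa using (tendsto_const_nhds (x := (1:ℝ))).sub
        (tendsto_one_div_add_atTop_nhds_zero_nat (𝕜 := ℝ))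
    have := (d0.mul_const R.1).prodMk_nhds (d0.mul_const R.2)
    simpa using this

end Fin

/-- **Proposition 3.** If `p_{Y1|X}` is essentially more capable than `p_{Y2|X}`,
then `𝒞₂(p_{Y1,Y2|X})` is the set of `(R1,R2) ∈ ℝ²₊` with `R2 ≤ I(X;Y2)` and
`R1+R2 ≤ I(X;Y1)` for some input distribution `p_X`. -/
theorem cap2_of_essMoreCapable
    {X Y1 Y2 : Type} [Fintype X] [Fintype Y1] [Fintype Y2]
    [Nonempty X] [Nonempty Y1] [Nonempty Y2]
    (W : X → Y1 × Y2 → ℝ) (hW : IsChannel W)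
    (hmc : EssMoreCapable W) :
    Cap2 W = {R : ℝ × ℝ | 0 ≤ R.1 ∧ 0 ≤ R.2 ∧ ∃ pX : X → ℝ, IsPMF pX ∧
      R.2 ≤ IXY (margW2 W) pX ∧ R.1 + R.2 ≤ IXY (margW1 W) pX} := by
  ext R
  constructor
  · intro hR
    exact conv_closure W hW hmc R hR
  · rintro ⟨h1, h2, pX, hp, b2, b1⟩
    exact ach_closure W hW R h1 h2 pX hp b2 b1

end
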